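/- Breaking of the unified interlacing for ε > 1: for every real ν ≥ 0 and every real ε > 1 there exists an integer s ≥ 1 such that y_{ν+ε,s} > j_{ν,s}; in particular, the chain j′_{ν,s} < y_{ν,s} < y_{ν+ε,s} < y′_{ν,s} < j_{ν,s} < j_{ν+ε,s} < j′_{ν,s+1} fails for some s. -/

import Mathlib

open Real Filter

/-- Bessel function of the first kind of real order `ν`:
`J_ν(x) = Σ_{k=0}^∞ ((−1)^k / (k! · Γ(ν+k+1))) · (x/2)^{ν+2k}`. -/
noncomputable def besselJ (ν : ℝ) (x : ℝ) : ℝ :=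
  ∑' k : ℕ, ((-1 : ℝ) ^ k / ((k.factorial : ℝ) * Real.Gamma (ν + k + 1))) *
    (x / 2) ^ (ν + 2 * (k : ℝ))

/-- Bessel function of the second kind of real order `ν`, defined as the limit
`Y_ν(x) = lim_{μ→ν, μ ∉ ℤ} (J_μ(x)·cos(μπ) − J_{−μ}(x)) / sin(μπ)`. -/
noncomputable def besselY (ν : ℝ) (x : ℝ) : ℝ :=
  limUnder (nhdsWithin ν {μ : ℝ | ∀ n : ℤ, μ ≠ (n : ℝ)})
    fun μ => (besselJ μ x * Real.cos (μ * π) - besselJ (-μ) x) / Real.sin (μ * π)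

/-- `z s`, for integers `s ≥ 1`, enumerates all the positive real zeros of `f`
in strictly increasing order. -/
structure IsPosZeroSeq (f : ℝ → ℝ) (z : ℕ → ℝ) : Prop where
  pos : ∀ s, 1 ≤ s → 0 < z s
  mono : ∀ s t, 1 ≤ s → s < t → z s < z t
  isZero : ∀ s, 1 ≤ s → f (z s) = 0
  complete : ∀ x, 0 < x → f x = 0 → ∃ s, 1 ≤ s ∧ z s = x

/-- `z s`, for integers `s ≥ 1`, enumerates the zeros `j'_{ν,s}` of `J'_ν`
(increasingly), with the convention that `x = 0` is counted as the first zero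
`j'_{0,1}` of `J'_0`. -/
def IsBesselJDerivZeroSeq (ν : ℝ) (z : ℕ → ℝ) : Prop :=
  (ν = 0 → z 1 = 0 ∧ IsPosZeroSeq (deriv (besselJ 0)) fun s => z (s + 1)) ∧
  (ν ≠ 0 → IsPosZeroSeq (deriv (besselJ ν)) z)

/-- The entire function `z ↦ ∑ (-1)^k z^k / (k! Γ(ν + k + 1))`. -/
noncomputable def besselCoeff (ν : ℝ) (k : ℕ) : ℝ :=
  (-1 : ℝ) ^ k / ((k.factorial : ℝ) * Real.Gamma (ν + k + 1))

noncomputable def besselCore (ν z : ℝ) : ℝ := ∑' k : ℕ, besselCoeff ν k * z ^ k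

lemma one_le_Gamma_of_two_le {x : ℝ} (hx : 2 ≤ x) : 1 ≤ Real.Gamma x := by
  rw [← Real.Gamma_two]
  exact Real.Gamma_strictMonoOn_Ici.monotoneOn Set.self_mem_Ici hx hx

lemma abs_besselCoeff_le {ν : ℝ} {k : ℕ} (h : 1 ≤ ν + k) :
    |besselCoeff ν k| ≤ 1 / (k.factorial : ℝ) := by
  have h1 : 1 ≤ Real.Gamma (ν + k + 1) := one_le_Gamma_of_two_le (by linarith)
  have h2 : (0 : ℝ) < k.factorial := by positivity
  unfold besselCoeff
  rw [abs_div, abs_pow, abs_neg, abs_one, one_pow, abs_of_pos (by positivity)]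
  apply one_div_le_one_div_of_le h2
  nlinarith

lemma summable_abs_besselCoeff (ν r : ℝ) : Summable fun k => |besselCoeff ν k| * |r| ^ k := by
  have hs := Real.summable_pow_div_factorial |r|
  refine Summable.of_norm_bounded_eventually_nat hs ?_
  filter_upwards [eventually_ge_atTop ⌈1 - ν⌉₊] with k hk
  have hk' : 1 - ν ≤ k := (Nat.le_ceil _).trans (by exact_mod_cast hk)
  rw [norm_mul, Real.norm_eq_abs, abs_abs, norm_pow, Real.norm_eq_abs, abs_abs, div_eq_mul_one_div,
    mul_comm]
  exact mul_le_mul_of_nonneg_left (abs_besselCoeff_le (by linarith)) (by positivity)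

lemma summable_besselCoeff (ν z : ℝ) : Summable fun k => besselCoeff ν k * z ^ k := by
  refine Summable.of_norm ?_
  simpa [abs_mul, abs_pow] using summable_abs_besselCoeff ν z

lemma besselCoeff_succ (ν : ℝ) (k : ℕ) :
    besselCoeff ν (k + 1) * (k + 1) = -besselCoeff (ν + 1) k := by
  unfold besselCoeff
  rw [Nat.factorial_succ]
  have : ν + ((k + 1 : ℕ) : ℝ) + 1 = ν + 1 + k + 1 := by push_cast; ring
  rw [this]
  have h1 : ((k : ℝ) + 1) ≠ 0 := by positivity
  have h2 : (k.factorial : ℝ) ≠ 0 := by positivity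
  push_cast
  by_cases h : Real.Gamma (ν + 1 + k + 1) = 0
  · simp [h]
  · field_simp
    ring

lemma besselCoeff_sub_one (ν : ℝ) (k : ℕ) :
    besselCoeff (ν - 1) k = (ν + k) * besselCoeff ν k := by
  unfold besselCoeff
  have e1 : ν - 1 + k + 1 = ν + k := by ring
  rw [e1]
  by_cases h : ν + k = 0
  · rw [h, Real.Gamma_zero]; simp
  · rw [Real.Gamma_add_one h]
    have h2 : (k.factorial : ℝ) ≠ 0 := by positivity
    by_cases hG : Real.Gamma (ν + k) = 0
    · simp [hG]
    · field_simp

lemma hasDerivAt_besselCore (ν z : ℝ) :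
    HasDerivAt (besselCore ν) (-besselCore (ν + 1) z) z := by
  set R := |z| + 1
  have hR : 0 < R := by positivity
  have key : ∀ w : ℝ, ∀ k : ℕ, besselCoeff ν (k + 1) * (((k + 1 : ℕ) : ℝ) * w ^ k)
      = -(besselCoeff (ν + 1) k * w ^ k) := by
    intro w k
    have := besselCoeff_succ ν k
    push_cast
    rw [← mul_assoc, this]; ring
  have hu : Summable fun k => |besselCoeff ν k| * ((k : ℝ) * R ^ (k - 1)) := by
    rw [← summable_nat_add_iff 1]
    refine (summable_abs_besselCoeff (ν + 1) R).congr fun k => ?_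
    have := congrArg abs (key R k)
    rw [abs_mul, abs_neg, abs_mul, abs_mul, abs_pow, abs_of_pos hR, Nat.abs_cast] at this
    rw [abs_of_pos hR, ← this, Nat.add_sub_cancel]
  have h := hasDerivAt_tsum_of_isPreconnected (t := Metric.ball 0 R)
    (g := fun k w => besselCoeff ν k * w ^ k)
    (g' := fun k w => besselCoeff ν k * ((k : ℝ) * w ^ (k - 1))) (y₀ := 0) (y := z) hu
    Metric.isOpen_ball (convex_ball (0 : ℝ) R).isPreconnected
    (fun k w _ => (hasDerivAt_pow k w).const_mul _) ?_ (by simpa using hR)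
    (summable_besselCoeff ν 0) (by simp [R])
  · refine HasDerivAt.congr_deriv (f := besselCore ν) h ?_
    have hs : Summable fun k => besselCoeff ν k * ((k : ℝ) * z ^ (k - 1)) := by
      rw [← summable_nat_add_iff 1]
      refine (summable_besselCoeff (ν + 1) z).neg.congr fun k => ?_
      rw [Nat.add_sub_cancel, key]
    rw [hs.tsum_eq_zero_add]
    simp only [Nat.add_sub_cancel, key, tsum_neg]
    simp [besselCore]
  · intro k w hw
    rw [norm_mul, norm_mul, norm_pow, Real.norm_eq_abs, Real.norm_eq_abs, Real.norm_eq_abs,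
      Nat.abs_cast]
    have : |w| ≤ R := by simpa using (Metric.mem_ball.1 hw).le
    gcongr

lemma besselCore_sub_one (ν z : ℝ) :
    besselCore (ν - 1) z = ν * besselCore ν z - z * besselCore (ν + 1) z := by
  have hs1 := summable_besselCoeff ν z
  have hk : ∀ k : ℕ, besselCoeff ν (k + 1) * ((k + 1 : ℕ) : ℝ) * z ^ (k + 1)
      = -z * (besselCoeff (ν + 1) k * z ^ k) := by
    intro k
    have := besselCoeff_succ ν k
    push_cast
    rw [this]; ring
  have hs2 : Summable fun k : ℕ => besselCoeff ν k * (k : ℝ) * z ^ k := by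
    rw [← summable_nat_add_iff 1]
    exact ((summable_besselCoeff (ν + 1) z).mul_left (-z)).congr fun k => (hk k).symm
  have h2 : ∑' k : ℕ, besselCoeff ν k * (k : ℝ) * z ^ k = -z * besselCore (ν + 1) z := by
    rw [hs2.tsum_eq_zero_add]
    simp only [hk, tsum_mul_left]
    simp [besselCore]
  have : besselCore (ν - 1) z
      = ∑' k : ℕ, (ν * (besselCoeff ν k * z ^ k) + besselCoeff ν k * (k : ℝ) * z ^ k) := by
    unfold besselCore
    congr 1; ext k
    rw [besselCoeff_sub_one]; ring
  rw [this, (hs1.mul_left ν).tsum_add hs2, h2, tsum_mul_left]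
  unfold besselCore
  ring

lemma analyticOnNhd_besselCore (ν : ℝ) : AnalyticOnNhd ℝ (besselCore ν) Set.univ := by
  set p := FormalMultilinearSeries.ofScalars ℝ (besselCoeff ν)
  have hr : p.radius = ⊤ := by
    refine FormalMultilinearSeries.radius_eq_top_of_summable_norm _ fun r => ?_
    refine (summable_abs_besselCoeff ν r).congr fun k => ?_
    rw [FormalMultilinearSeries.ofScalars_norm]
    simp
  have h := p.hasFPowerSeriesOnBall (by rw [hr]; exact ENNReal.zero_lt_top)
  have h2 : p.sum = besselCore ν := by
    ext z
    simp [p, FormalMultilinearSeries.sum, besselCore, mul_comm]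
  rw [h2] at h
  have := h.analyticOnNhd
  rwa [hr, Metric.eball_top] at this

lemma besselCore_zero_right (ν : ℝ) : besselCore ν 0 = 1 / Real.Gamma (ν + 1) := by
  unfold besselCore
  rw [tsum_eq_single 0]
  · simp [besselCoeff]
  · intro k hk; simp [hk]

lemma besselJ_eq {x : ℝ} (ν : ℝ) (hx : 0 < x) :
    besselJ ν x = (x / 2) ^ ν * besselCore ν (x ^ 2 / 4) := by
  unfold besselJ besselCore besselCoeff
  rw [← tsum_mul_left]
  congr 1; ext k
  have h : (x / 2) ^ (ν + 2 * (k : ℝ)) = (x / 2) ^ ν * (x ^ 2 / 4) ^ k := by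
    rw [Real.rpow_add (by positivity)]
    congr 1
    rw [show (2 : ℝ) * k = ((2 * k : ℕ) : ℝ) by push_cast; ring, Real.rpow_natCast, pow_mul]
    congr 1; ring
  rw [h]; ring

lemma besselJ_sub_one {x : ℝ} (ν : ℝ) (hx : 0 < x) :
    besselJ (ν - 1) x = 2 * ν / x * besselJ ν x - besselJ (ν + 1) x := by
  rw [besselJ_eq _ hx, besselJ_eq _ hx, besselJ_eq _ hx, besselCore_sub_one,
    Real.rpow_sub_one (by positivity), Real.rpow_add_one (by positivity)]
  field_simp
  ring

lemma hasDerivAt_besselJ {x : ℝ} (ν : ℝ) (hx : 0 < x) :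
    HasDerivAt (besselJ ν) (ν / x * besselJ ν x - besselJ (ν + 1) x) x := by
  have h1 : HasDerivAt (fun y : ℝ => (y / 2) ^ ν * besselCore ν (y ^ 2 / 4))
      (ν / x * besselJ ν x - besselJ (ν + 1) x) x := by
    have ha : HasDerivAt (fun y : ℝ => (y / 2) ^ ν) (1 / 2 * ν * (x / 2) ^ (ν - 1)) x :=
      ((hasDerivAt_id x).div_const 2).rpow_const (Or.inl (by simp; positivity))
    have hb : HasDerivAt (fun y : ℝ => besselCore ν (y ^ 2 / 4))
        (-besselCore (ν + 1) (x ^ 2 / 4) * (2 * x / 4)) x := by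
      have := ((hasDerivAt_pow 2 x).div_const 4)
      refine (hasDerivAt_besselCore ν (x ^ 2 / 4)).comp x (this.congr_deriv ?_)
      simp
    refine (ha.mul hb).congr_deriv ?_
    rw [besselJ_eq _ hx, besselJ_eq _ hx, Real.rpow_sub_one (by positivity),
      Real.rpow_add_one (by positivity)]
    field_simp
    ring
  refine h1.congr_of_eventuallyEq ?_
  filter_upwards [lt_mem_nhds hx] with y hy using besselJ_eq ν hy

lemma continuousOn_besselJ (ν : ℝ) : ContinuousOn (besselJ ν) (Set.Ioi 0) :=
  fun _ hx => (hasDerivAt_besselJ ν hx).continuousAt.continuousWithinAt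

lemma finite_zeros_besselJ {ν : ℝ} (hν : 0 ≤ ν) (X : ℝ) :
    {x | 0 < x ∧ x ≤ X ∧ besselJ ν x = 0}.Finite := by
  set g : ℝ → ℝ := fun x => besselCore ν (x ^ 2 / 4)
  have hg : AnalyticOnNhd ℝ g Set.univ := by
    refine (analyticOnNhd_besselCore ν).comp (fun x _ => ?_) (fun _ _ => Set.mem_univ _)
    fun_prop
  have hg0 : g 0 ≠ 0 := by
    simp only [g]
    norm_num [besselCore_zero_right]
    exact (Real.Gamma_pos_of_pos (by linarith)).ne'
  by_contra hinf
  obtain ⟨p, -, hp⟩ := Set.Infinite.exists_accPt_of_subset_isCompact hinf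
    (isCompact_Icc (a := (0 : ℝ)) (b := X)) (fun x hx => ⟨hx.1.le, hx.2.1⟩)
  rw [accPt_iff_frequently_nhdsNE] at hp
  have := hg.eqOn_zero_of_preconnected_of_frequently_eq_zero isPreconnected_univ
    (Set.mem_univ p) (hp.mono fun x hx => by
      have h := hx.2.2
      rw [besselJ_eq _ hx.1] at h
      exact (mul_eq_zero.1 h).resolve_left (Real.rpow_pos_of_pos (by linarith [hx.1]) _).ne')
  exact hg0 (this (Set.mem_univ 0))

/-- The function `x J'_ν(x)`, in terms of Bessel functions. -/
noncomputable def besselD (ν x : ℝ) : ℝ := ν * besselJ ν x - x * besselJ (ν + 1) x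

lemma hasDerivAt_besselJ' {x : ℝ} (ν : ℝ) (hx : 0 < x) :
    HasDerivAt (besselJ ν) (besselD ν x / x) x := by
  refine (hasDerivAt_besselJ ν hx).congr_deriv ?_
  unfold besselD
  field_simp

lemma hasDerivAt_besselD {x : ℝ} (ν : ℝ) (hx : 0 < x) :
    HasDerivAt (besselD ν) ((ν ^ 2 / x - x) * besselJ ν x) x := by
  have h := ((hasDerivAt_besselJ ν hx).const_mul ν).sub
    ((hasDerivAt_id x).mul (hasDerivAt_besselJ (ν + 1) hx))
  refine HasDerivAt.congr_deriv (f := besselD ν) h ?_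
  have hr := besselJ_sub_one (ν + 1) hx
  rw [add_sub_cancel_right] at hr
  have h2 : besselJ (ν + 1 + 1) x = 2 * (ν + 1) / x * besselJ (ν + 1) x - besselJ ν x := by
    rw [hr]; ring
  simp only [id]
  rw [h2]
  field_simp
  ring

/-- The modified Wronskian `x (J_ν J'_κ - J'_ν J_κ)`. -/
noncomputable def besselW (ν κ x : ℝ) : ℝ :=
  besselJ ν x * besselD κ x - besselD ν x * besselJ κ x

lemma hasDerivAt_besselW {x : ℝ} (ν κ : ℝ) (hx : 0 < x) :
    HasDerivAt (besselW ν κ) ((κ ^ 2 - ν ^ 2) / x * (besselJ ν x * besselJ κ x)) x := by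
  have h := ((hasDerivAt_besselJ' ν hx).mul (hasDerivAt_besselD κ hx)).sub
    ((hasDerivAt_besselD ν hx).mul (hasDerivAt_besselJ' κ hx))
  refine HasDerivAt.congr_deriv (f := besselW ν κ) h ?_
  field_simp
  ring

/-- The function `besselW ν κ` without its power factor. -/
noncomputable def besselWCore (ν κ x : ℝ) : ℝ :=
  besselCore ν (x ^ 2 / 4) * (κ * besselCore κ (x ^ 2 / 4)
      - x ^ 2 / 2 * besselCore (κ + 1) (x ^ 2 / 4))
    - (ν * besselCore ν (x ^ 2 / 4) - x ^ 2 / 2 * besselCore (ν + 1) (x ^ 2 / 4))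
      * besselCore κ (x ^ 2 / 4)

lemma continuous_besselWCore (ν κ : ℝ) : Continuous (besselWCore ν κ) := by
  have h (μ : ℝ) : Continuous fun x : ℝ => besselCore μ (x ^ 2 / 4) := by
    have : Continuous (besselCore μ) :=
      continuous_iff_continuousAt.2 fun z => (hasDerivAt_besselCore μ z).continuousAt
    exact this.comp (by fun_prop)
  have := h ν
  have := h κ
  have := h (ν + 1)
  have := h (κ + 1)
  unfold besselWCore
  fun_prop

lemma besselW_eq {x : ℝ} (ν κ : ℝ) (hx : 0 < x) :
    besselW ν κ x = (x / 2) ^ (ν + κ) * besselWCore ν κ x := by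
  unfold besselW besselD besselWCore
  rw [besselJ_eq _ hx, besselJ_eq _ hx, besselJ_eq _ hx, besselJ_eq _ hx,
    Real.rpow_add_one (by positivity), Real.rpow_add_one (by positivity),
    Real.rpow_add (by positivity)]
  ring

lemma besselW_neg {x : ℝ} {ν : ℝ} (hν : ∀ n : ℤ, ν ≠ n) (hx : 0 < x) :
    besselW ν (-ν) x = -(2 * Real.sin (ν * π) / π) := by
  have hc : ∀ y, 0 < y → besselWCore ν (-ν) y = besselWCore ν (-ν) x := by
    intro y hy
    have hd : ∀ z ∈ Set.Ioi (0 : ℝ), HasDerivAt (besselW ν (-ν)) 0 z := by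
      intro z hz
      refine (hasDerivAt_besselW ν (-ν) hz).congr_deriv ?_
      ring
    have := (convex_Ioi (0 : ℝ)).is_const_of_fderivWithin_eq_zero (𝕜 := ℝ)
      (f := besselW ν (-ν))
      (fun z hz => (hd z hz).differentiableAt.differentiableWithinAt)
      (fun z hz => by
        rw [fderivWithin_of_isOpen isOpen_Ioi hz]
        ext
        simp [(hd z hz).deriv]) hy hx
    rw [besselW_eq _ _ hy, besselW_eq _ _ hx] at this
    simpa using this
  have hlim : Tendsto (besselWCore ν (-ν)) (nhdsWithin 0 (Set.Ioi 0))
      (nhds (besselWCore ν (-ν) 0)) :=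
    (continuous_besselWCore ν (-ν)).continuousAt.tendsto.mono_left nhdsWithin_le_nhds
  have hlim2 : Tendsto (besselWCore ν (-ν)) (nhdsWithin 0 (Set.Ioi 0))
      (nhds (besselWCore ν (-ν) x)) := by
    refine tendsto_const_nhds.congr' ?_
    filter_upwards [self_mem_nhdsWithin] with y hy using (hc y hy).symm
  have h0 := tendsto_nhds_unique hlim hlim2
  rw [besselW_eq _ _ hx, ← h0, add_neg_cancel, Real.rpow_zero, one_mul]
  have hν0 : ν ≠ 0 := by simpa using hν 0
  have hs : Real.sin (π * ν) ≠ 0 := by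
    rw [Real.sin_ne_zero_iff]
    intro n h
    exact hν n (by field_simp at h; linarith)
  have hG := Real.Gamma_mul_Gamma_one_sub ν
  simp only [besselWCore, besselCore_zero_right, ne_eq, OfNat.ofNat_ne_zero, not_false_eq_true,
    zero_pow, zero_div, zero_mul, sub_zero]
  rw [Real.Gamma_add_one hν0, show -ν + 1 = 1 - ν by ring, mul_comm ν π]
  have hne : Real.Gamma ν * Real.Gamma (1 - ν) ≠ 0 := by
    rw [hG]; positivity
  have h1 := left_ne_zero_of_mul hne
  have h2 := right_ne_zero_of_mul hne
  have : 1 / (ν * Real.Gamma ν) * (-ν * (1 / Real.Gamma (1 - ν))) -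
      ν * (1 / (ν * Real.Gamma ν)) * (1 / Real.Gamma (1 - ν))
      = -(2 * (1 / (Real.Gamma ν * Real.Gamma (1 - ν)))) := by
    field_simp; ring
  rw [this, hG]
  field_simp

lemma deriv_nonpos_of_pos_left {f : ℝ → ℝ} {a b f' : ℝ} (hab : a < b) (h : HasDerivAt f f' b)
    (hb : f b = 0) (hpos : ∀ x ∈ Set.Ioo a b, 0 ≤ f x) : f' ≤ 0 := by
  have := (hasDerivWithinAt_iff_tendsto_slope' (s := Set.Iio b) (by simp)).1 h.hasDerivWithinAt
  refine le_of_tendsto this ?_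
  filter_upwards [Ioo_mem_nhdsLT hab] with x hx
  rw [slope_def_field, hb, sub_zero]
  exact div_nonpos_of_nonneg_of_nonpos (hpos x hx) (by linarith [hx.2])

lemma deriv_nonneg_of_pos_right {f : ℝ → ℝ} {a b f' : ℝ} (hab : a < b) (h : HasDerivAt f f' a)
    (ha : f a = 0) (hpos : ∀ x ∈ Set.Ioo a b, 0 ≤ f x) : 0 ≤ f' := by
  have := (hasDerivWithinAt_iff_tendsto_slope' (s := Set.Ioi a) (by simp)).1 h.hasDerivWithinAt
  refine ge_of_tendsto this ?_
  filter_upwards [Ioo_mem_nhdsGT hab] with x hx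
  rw [slope_def_field, ha, sub_zero]
  exact div_nonneg (hpos x hx) (by linarith [hx.1])

/-- A continuous nonvanishing function on an open interval has constant sign. -/
lemma exists_sign_mul_pos {f : ℝ → ℝ} {a b : ℝ} (hf : ContinuousOn f (Set.Ioo a b))
    (h0 : ∀ x ∈ Set.Ioo a b, f x ≠ 0) :
    ∃ s : ℝ, ∀ x ∈ Set.Ioo a b, 0 < s * f x := by
  by_cases h : ∃ x ∈ Set.Ioo a b, 0 < f x
  · obtain ⟨x, hx, hfx⟩ := h
    refine ⟨1, fun y hy => ?_⟩
    rw [one_mul]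
    by_contra hy0
    obtain ⟨z, hz, hz0⟩ := isPreconnected_Ioo.intermediate_value hy hx hf
      ⟨not_lt.1 hy0, hfx.le⟩
    exact h0 z hz hz0
  · push Not at h
    exact ⟨-1, fun y hy => by linarith [lt_of_le_of_ne (h y hy) (h0 y hy)]⟩

lemma exists_besselJ_zero_of_interval {ν κ a b : ℝ} (hν : 0 ≤ ν) (hκ : ν < κ) (ha : 0 ≤ a)
    (hab : a < b) (ha0 : 0 < a → besselJ κ a = 0) (hb : besselJ κ b = 0)
    (hne : ∀ x ∈ Set.Ioo a b, besselJ κ x ≠ 0) : ∃ c ∈ Set.Ioo a b, besselJ ν c = 0 := by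
  by_contra! hcon
  have hb0 : 0 < b := ha.trans_lt hab
  have hsub : Set.Ioo a b ⊆ Set.Ioi 0 := fun x hx => ha.trans_lt hx.1
  obtain ⟨s, hs⟩ := exists_sign_mul_pos ((continuousOn_besselJ κ).mono hsub) hne
  obtain ⟨t, ht⟩ := exists_sign_mul_pos ((continuousOn_besselJ ν).mono hsub) hcon
  set V : ℝ → ℝ := fun x => s * t * ((x / 2) ^ (ν + κ) * besselWCore ν κ x)
  have hV : ∀ x, 0 < x → V x = s * t * besselW ν κ x := fun x hx => by
    simp only [V]; rw [besselW_eq _ _ hx]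
  have hmono : StrictMonoOn V (Set.Icc a b) := by
    refine strictMonoOn_of_deriv_pos (convex_Icc a b) ?_ ?_
    · have := continuous_besselWCore ν κ
      refine Continuous.continuousOn ?_
      refine continuous_const.mul (Continuous.mul ?_ this)
      exact (continuous_id.div_const 2).rpow_const fun x => Or.inr (by linarith)
    · intro x hx
      rw [interior_Icc] at hx
      have hx0 : 0 < x := hsub hx
      have hd : HasDerivAt V
          (s * t * ((κ ^ 2 - ν ^ 2) / x * (besselJ ν x * besselJ κ x))) x := by
        refine ((hasDerivAt_besselW ν κ hx0).const_mul (s * t)).congr_of_eventuallyEq ?_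
        filter_upwards [lt_mem_nhds hx0] with y hy using hV y hy
      rw [hd.deriv]
      have h1 : 0 < (κ ^ 2 - ν ^ 2) / x := div_pos (by nlinarith) hx0
      have h2 := mul_pos (hs x hx) (ht x hx)
      calc 0 < (κ ^ 2 - ν ^ 2) / x * (s * besselJ κ x * (t * besselJ ν x)) := mul_pos h1 h2
        _ = _ := by ring
  have hclos : ∀ x ∈ Set.Icc a b, 0 < x → 0 ≤ t * besselJ ν x := by
    intro x hx hx0
    have hcl : x ∈ closure (Set.Ioo a b) := by rwa [closure_Ioo hab.ne]
    have hc : ContinuousAt (fun x => t * besselJ ν x) x :=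
      (hasDerivAt_besselJ ν hx0).continuousAt.const_mul t
    have := mem_closure_iff_nhdsWithin_neBot.1 hcl
    refine ge_of_tendsto (hc.tendsto.mono_left (nhdsWithin_le_nhds (s := Set.Ioo a b))) ?_
    filter_upwards [self_mem_nhdsWithin] with y hy using (ht y hy).le
  have hVb : V b ≤ 0 := by
    have h1 := deriv_nonpos_of_pos_left hab ((hasDerivAt_besselJ' κ hb0).const_mul s)
      (by simp [hb]) (fun x hx => (hs x hx).le)
    have h2 : s * besselD κ b ≤ 0 := by
      have := mul_nonpos_of_nonpos_of_nonneg h1 hb0.le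
      field_simp at this
      simpa using this
    rw [hV b hb0, besselW, hb, mul_zero, sub_zero]
    have := mul_nonpos_of_nonneg_of_nonpos (hclos b (Set.right_mem_Icc.2 hab.le) hb0) h2
    linarith
  have hVa : 0 ≤ V a := by
    rcases ha.eq_or_lt with h | h
    · simp only [V]
      rw [← h, zero_div, Real.zero_rpow (by linarith)]
      simp
    · have h1 := deriv_nonneg_of_pos_right hab ((hasDerivAt_besselJ' κ h).const_mul s)
        (by simp [ha0 h]) (fun x hx => (hs x hx).le)
      have h2 : 0 ≤ s * besselD κ a := by
        have := mul_nonneg h1 h.le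
        field_simp at this
        simpa using this
      rw [hV a h, besselW, ha0 h, mul_zero, sub_zero]
      have := mul_nonneg (hclos a (Set.left_mem_Icc.2 hab.le) h) h2
      linarith
  have := hmono (Set.left_mem_Icc.2 hab.le) (Set.right_mem_Icc.2 hab.le) hab
  linarith

/-- The positive zeros of `J_ν` up to `X`. -/
def besselJZeros (ν X : ℝ) : Set ℝ := {x | 0 < x ∧ x ≤ X ∧ besselJ ν x = 0}

lemma besselJZeros_mono (ν : ℝ) {X Y : ℝ} (h : X ≤ Y) : besselJZeros ν X ⊆ besselJZeros ν Y :=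
  fun _ hx => ⟨hx.1, hx.2.1.trans h, hx.2.2⟩

lemma exists_besselJ_zero_between {ν κ b : ℝ} (hν : 0 ≤ ν) (hκ : ν < κ) (hb0 : 0 < b)
    (hb : besselJ κ b = 0) :
    ∃ c, 0 < c ∧ c < b ∧ besselJ ν c = 0 ∧ ∀ a, 0 < a → a < b → besselJ κ a = 0 → a < c := by
  set S := besselJZeros κ b \ {b}
  have hfin : S.Finite := (finite_zeros_besselJ (hν.trans hκ.le) b).subset Set.sdiff_subset
  have hmem : ∀ a, 0 < a → a < b → besselJ κ a = 0 → a ∈ S :=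
    fun a h1 h2 h3 => ⟨⟨h1, h2.le, h3⟩, h2.ne⟩
  obtain ⟨a, ha0, hab, haz, hamax⟩ : ∃ a, 0 ≤ a ∧ a < b ∧ (0 < a → besselJ κ a = 0) ∧
      ∀ x ∈ S, x ≤ a := by
    rcases S.eq_empty_or_nonempty with h | h
    · exact ⟨0, le_rfl, hb0, fun h => (lt_irrefl _ h).elim, by simp [h]⟩
    · obtain ⟨a, ha, hmax⟩ := Set.exists_max_image S id hfin h
      exact ⟨a, ha.1.1.le, lt_of_le_of_ne ha.1.2.1 ha.2, fun _ => ha.1.2.2, hmax⟩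
  obtain ⟨c, hc, hc0⟩ := exists_besselJ_zero_of_interval hν hκ ha0 hab haz hb
    (fun x hx h => (hamax x (hmem x (ha0.trans_lt hx.1) hx.2 h)).not_gt hx.1)
  exact ⟨c, ha0.trans_lt hc.1, hc.2, hc0, fun x h1 h2 h3 =>
    (hamax x (hmem x h1 h2 h3)).trans_lt hc.1⟩

/-- Sturm comparison: `J_κ` has at most as many zeros on `(0, X]` as `J_ν` if `0 ≤ ν < κ`. -/
lemma encard_besselJZeros_le {ν κ : ℝ} (hν : 0 ≤ ν) (hκ : ν < κ) (X : ℝ) :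
    (besselJZeros κ X).encard ≤ (besselJZeros ν X).encard := by
  have h : ∀ b : ℝ, ∃ c, 0 < b → besselJ κ b = 0 → 0 < c ∧ c < b ∧ besselJ ν c = 0 ∧
      ∀ a, 0 < a → a < b → besselJ κ a = 0 → a < c := by
    intro b
    by_cases hb : 0 < b ∧ besselJ κ b = 0
    · obtain ⟨c, hc⟩ := exists_besselJ_zero_between hν hκ hb.1 hb.2
      exact ⟨c, fun _ _ => hc⟩
    · exact ⟨0, fun h1 h2 => (hb ⟨h1, h2⟩).elim⟩
  choose φ hφ using h
  have hinj : Set.InjOn φ (besselJZeros κ X) := by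
    have hlt : ∀ x ∈ besselJZeros κ X, ∀ y ∈ besselJZeros κ X, x < y → φ x < φ y :=
      fun x hx y hy hxy => (hφ x hx.1 hx.2.2).2.1.trans
        ((hφ y hy.1 hy.2.2).2.2.2 x hx.1 hxy hx.2.2)
    intro x hx y hy hxy
    rcases lt_trichotomy x y with h | h | h
    · exact absurd hxy (hlt x hx y hy h).ne
    · exact h
    · exact absurd hxy (hlt y hy x hx h).ne'
  rw [← hinj.encard_image]
  refine Set.encard_le_encard ?_
  rintro _ ⟨x, hx, rfl⟩
  obtain ⟨h1, h2, h3, -⟩ := hφ x hx.1 hx.2.2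
  exact ⟨h1, h2.le.trans hx.2.1, h3⟩

open MeasureTheory Set in
lemma integral_Ioo_beta {u v : ℝ} (hu : 0 < u) (hv : 0 < v) :
    ∫ s in Ioo (0 : ℝ) 1, s ^ (u - 1) * (1 - s) ^ (v - 1)
      = Real.Gamma u * Real.Gamma v / Real.Gamma (u + v) := by
  have h := ProbabilityTheory.beta_eq_betaIntegralReal u v hu hv
  rw [ProbabilityTheory.beta] at h
  rw [h, Complex.betaIntegral, intervalIntegral.integral_of_le (by norm_num),
    integral_Ioc_eq_integral_Ioo]
  have : ∫ x in Ioo (0 : ℝ) 1, (x : ℂ) ^ ((u : ℂ) - 1) * (1 - (x : ℂ)) ^ ((v : ℂ) - 1)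
      = ∫ x in Ioo (0 : ℝ) 1, ((x ^ (u - 1) * (1 - x) ^ (v - 1) : ℝ) : ℂ) := by
    refine setIntegral_congr_fun measurableSet_Ioo fun x hx => ?_
    push_cast
    rw [Complex.ofReal_cpow hx.1.le, Complex.ofReal_cpow (by linarith [hx.2])]
    push_cast
    rfl
  rw [this, integral_complex_ofReal, Complex.ofReal_re]

open MeasureTheory Set in
lemma integral_Ioo_one_sub_sq_rpow {a : ℝ} (ha : -1 < a) (k : ℕ) :
    ∫ t in Ioo (0 : ℝ) 1, (1 - t ^ 2) ^ a * t ^ (2 * k)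
      = Real.Gamma (a + 1) * Real.Gamma (k + 1 / 2) / (2 * Real.Gamma (a + k + 3 / 2)) := by
  have himg : (fun t : ℝ => t ^ 2) '' Ioo 0 1 = Ioo 0 1 := by
    ext y
    constructor
    · rintro ⟨t, ht, rfl⟩
      exact ⟨by have := ht.1; positivity, by nlinarith [ht.1, ht.2]⟩
    · intro hy
      refine ⟨√y, ⟨Real.sqrt_pos.2 hy.1, ?_⟩, Real.sq_sqrt hy.1.le⟩
      rw [Real.sqrt_lt' one_pos]; linarith [hy.2]
  have hb := integral_Ioo_beta (u := k + 1 / 2) (v := a + 1) (by positivity) (by linarith)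
  rw [← himg, integral_image_eq_integral_abs_deriv_smul measurableSet_Ioo
    (f' := fun t => 2 * t)
    (fun t _ => by simpa using (hasDerivAt_pow 2 t).hasDerivWithinAt)
    (fun x hx y hy h => (pow_left_inj₀ hx.1.le hy.1.le two_ne_zero).1 h)] at hb
  have hc : ∫ t in Ioo (0 : ℝ) 1, |2 * t| • ((t ^ 2) ^ ((k : ℝ) + 1 / 2 - 1)
      * (1 - t ^ 2) ^ (a + 1 - 1)) = ∫ t in Ioo (0 : ℝ) 1, 2 * ((1 - t ^ 2) ^ a * t ^ (2 * k)) := by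
    refine setIntegral_congr_fun measurableSet_Ioo fun t ht => ?_
    have ht0 := ht.1
    have e : (t ^ 2) ^ ((k : ℝ) + 1 / 2 - 1) = t ^ (2 * k) / t := by
      rw [← Real.rpow_natCast_mul ht0.le, show ((2 : ℕ) : ℝ) * ((k : ℝ) + 1 / 2 - 1)
        = ((2 * k : ℕ) : ℝ) - 1 by push_cast; ring, Real.rpow_sub_one ht0.ne', Real.rpow_natCast]
    simp only [smul_eq_mul]
    rw [e, abs_of_pos (by positivity), add_sub_cancel_right]
    field_simp
  rw [hc, integral_const_mul] at hb
  rw [show a + k + 3 / 2 = k + 1 / 2 + (a + 1) by ring]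
  have hG := Real.Gamma_pos_of_pos (show 0 < (k : ℝ) + 1 / 2 + (a + 1) by
    have : (0 : ℝ) ≤ k := by positivity
    linarith)
  rw [eq_div_iff_mul_eq hG.ne'] at hb
  rw [eq_div_iff_mul_eq (by positivity)]
  linarith

open MeasureTheory Set in
lemma integrableOn_one_sub_sq_rpow {a : ℝ} (ha : -1 < a) (k : ℕ) :
    IntegrableOn (fun t : ℝ => (1 - t ^ 2) ^ a * t ^ (2 * k)) (Ioo 0 1) := by
  refine not_imp_comm.1 integral_undef ?_
  rw [integral_Ioo_one_sub_sq_rpow ha]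
  have : (0 : ℝ) ≤ k := by positivity
  have h1 := Real.Gamma_pos_of_pos (show 0 < a + 1 by linarith)
  have h2 := Real.Gamma_pos_of_pos (show 0 < (k : ℝ) + 1 / 2 by linarith)
  have h3 := Real.Gamma_pos_of_pos (show 0 < a + k + 3 / 2 by linarith)
  positivity

lemma Gamma_nat_add_half_div_factorial (k : ℕ) :
    Real.Gamma (k + 1 / 2) / (2 * k).factorial = √π / (4 ^ k * k.factorial) := by
  rw [Real.Gamma_nat_add_half]
  have h1 : ((2 * k).factorial : ℝ) = 2 ^ k * k.factorial * (2 * k - 1).doubleFactorial := by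
    rcases k with _ | k
    · simp
    · rw [show 2 * (k + 1) = (2 * k + 1) + 1 by ring, Nat.factorial_eq_mul_doubleFactorial,
        show 2 * k + 1 + 1 = 2 * (k + 1) by ring, Nat.doubleFactorial_two_mul]
      rw [show 2 * (k + 1) - 1 = 2 * k + 1 by omega]
      push_cast
      ring
  have h2 : ((2 * k - 1).doubleFactorial : ℝ) ≠ 0 := by
    exact_mod_cast (Nat.doubleFactorial_pos _).ne'
  have h3 : (4 : ℝ) ^ k = 2 ^ k * 2 ^ k := by rw [← mul_pow]; norm_num
  rw [h1, h3]
  field_simp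

open MeasureTheory Set in
/-- The Poisson integral for `J_ν`. -/
lemma besselJ_eq_poisson {ν x : ℝ} (hν : -(1 / 2) < ν) (hx : 0 < x) :
    besselJ ν x = 2 * (x / 2) ^ ν / (√π * Real.Gamma (ν + 1 / 2))
      * ∫ t in Ioo (0 : ℝ) 1, (1 - t ^ 2) ^ (ν - 1 / 2) * Real.cos (x * t) := by
  set a := ν - 1 / 2 with ha_def
  have ha : -1 < a := by linarith
  set F : ℕ → ℝ → ℝ := fun k t =>
    (-1) ^ k * x ^ (2 * k) / (2 * k).factorial * ((1 - t ^ 2) ^ a * t ^ (2 * k))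
  have hFint : ∀ k, Integrable (F k) (volume.restrict (Ioo 0 1)) :=
    fun k => (integrableOn_one_sub_sq_rpow ha k).const_mul _
  have hnorm : ∀ k, ∫ t in Ioo (0 : ℝ) 1, ‖F k t‖ ≤ x ^ (2 * k) / (2 * k).factorial
      * ∫ t in Ioo (0 : ℝ) 1, (1 - t ^ 2) ^ a := by
    intro k
    rw [← integral_const_mul]
    refine setIntegral_mono_on (hFint k).norm ?_ measurableSet_Ioo fun t ht => ?_
    · have h := integrableOn_one_sub_sq_rpow ha 0
      simp only [mul_zero, pow_zero, mul_one] at h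
      exact h.const_mul _
    · have h1 : 0 ≤ (1 - t ^ 2) ^ a := Real.rpow_nonneg (by nlinarith [ht.1, ht.2]) _
      have h2 : t ^ (2 * k) ≤ 1 := pow_le_one₀ ht.1.le ht.2.le
      have h3 : 0 ≤ t ^ (2 * k) := by have := ht.1; positivity
      simp only [F, norm_mul, norm_div, norm_pow, norm_neg, norm_one, one_pow, one_mul,
        Real.norm_eq_abs, Nat.abs_cast, abs_of_pos hx, abs_of_nonneg h1, abs_of_pos ht.1]
      gcongr
      nlinarith
  have hsum : Summable fun k => ∫ t in Ioo (0 : ℝ) 1, ‖F k t‖ := by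
    refine Summable.of_nonneg_of_le (fun k => integral_nonneg fun t => norm_nonneg _) hnorm ?_
    refine Summable.mul_right _ ?_
    exact (Real.summable_pow_div_factorial x).comp_injective
      (i := fun k : ℕ => 2 * k) (fun a b h => by simpa using h)
  have hS := hasSum_integral_of_summable_integral_norm hFint hsum
  have hcos : ∀ t, ∑' k, F k t = (1 - t ^ 2) ^ a * Real.cos (x * t) := by
    intro t
    rw [← (Real.hasSum_cos (x * t)).tsum_eq, ← tsum_mul_left]
    congr 1; ext k
    simp only [F, mul_pow]; ring
  simp only [hcos] at hS
  rw [besselJ_eq _ hx, ← hS.tsum_eq, besselCore, ← tsum_mul_left, ← tsum_mul_left]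
  congr 1; ext k
  simp only [F]
  rw [integral_const_mul, integral_Ioo_one_sub_sq_rpow ha, besselCoeff]
  have hk : (0 : ℝ) ≤ k := by positivity
  have h1 := Real.Gamma_pos_of_pos (show 0 < ν + 1 / 2 by linarith)
  have h3 := Real.Gamma_pos_of_pos (show 0 < ν + k + 1 by linarith)
  rw [show a + 1 = ν + 1 / 2 by rw [ha_def]; ring, show a + k + 3 / 2 = ν + k + 1 by
    rw [ha_def]; ring]
  have h4 := Gamma_nat_add_half_div_factorial k
  have h5 : Real.Gamma (k + 1 / 2)
      = (2 * k).factorial * (√π / (4 ^ k * k.factorial)) := by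
    rw [← h4]; field_simp
  rw [h5]
  have : √π ≠ 0 := by positivity
  rw [div_pow, ← pow_mul]
  generalize Real.Gamma (ν + 1 / 2) = G at h1 ⊢
  field_simp

/-- The integrand of the Hankel-type integral
`∫_0^∞ e^{-u} u^a (1 + i w u)^a du`. -/
noncomputable def hankelKernel (a w u : ℝ) : ℂ :=
  ((Real.exp (-u) * u ^ a : ℝ) : ℂ) * (1 + (w * u : ℝ) * Complex.I) ^ (a : ℂ)

/-- The factor by which differentiation in the exponent multiplies `hankelKernel`. -/
noncomputable def hankelLog (w u : ℝ) : ℂ :=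
  (Real.log u : ℂ) + Complex.log (1 + (w * u : ℝ) * Complex.I)

lemma one_add_mul_I_mem_slitPlane (r : ℝ) : 1 + (r : ℂ) * Complex.I ∈ Complex.slitPlane :=
  Or.inl (by simp)

lemma one_le_norm_one_add_mul_I (r : ℝ) : 1 ≤ ‖1 + (r : ℂ) * Complex.I‖ := by
  simpa using Complex.abs_re_le_norm (1 + (r : ℂ) * Complex.I)

lemma norm_one_add_mul_I_le {K w u : ℝ} (hK : 1 ≤ K) (hw : 0 ≤ w) (hw1 : w ≤ K) (hu : 0 < u) :
    ‖1 + ((w * u : ℝ) : ℂ) * Complex.I‖ ≤ K * (1 + u) := by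
  refine (norm_add_le _ _).trans ?_
  rw [norm_mul, Complex.norm_real, Complex.norm_I, norm_one, mul_one, Real.norm_eq_abs,
    abs_of_nonneg (by positivity)]
  nlinarith

lemma integrableOn_one_add_pow_mul_exp_neg (c : ℝ) (n : ℕ) :
    MeasureTheory.IntegrableOn (fun u : ℝ => c * (1 + u) ^ n * Real.exp (-u)) (Set.Ioi 0) := by
  refine integrable_of_isBigO_exp_neg (b := 1 / 2) (by norm_num) (by fun_prop) ?_
  refine Asymptotics.IsBigO.of_bound (|c| * (2 ^ n * n.factorial * Real.exp (1 / 2))) ?_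
  filter_upwards [eventually_ge_atTop 0] with u hu
  have h := Real.pow_div_factorial_le_exp ((1 + u) / 2) (by positivity) n
  rw [div_le_iff₀ (by positivity), div_pow, div_le_iff₀ (by positivity)] at h
  have e : Real.exp (1 / 2) * Real.exp (-(1 / 2) * u) = Real.exp ((1 + u) / 2) * Real.exp (-u) := by
    rw [← Real.exp_add, ← Real.exp_add]; congr 1; ring
  rw [norm_mul, norm_mul, Real.norm_eq_abs, Real.norm_eq_abs, Real.norm_eq_abs, Real.norm_eq_abs,
    abs_of_pos (Real.exp_pos _), abs_of_pos (Real.exp_pos _),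
    abs_of_nonneg (show 0 ≤ (1 + u) ^ n by positivity)]
  calc |c| * (1 + u) ^ n * Real.exp (-u)
      ≤ |c| * (Real.exp ((1 + u) / 2) * n.factorial * 2 ^ n) * Real.exp (-u) := by gcongr
    _ = |c| * (2 ^ n * n.factorial) * (Real.exp ((1 + u) / 2) * Real.exp (-u)) := by ring
    _ = _ := by rw [← e]; ring

lemma norm_hankelKernel_le {a K w u : ℝ} {N : ℕ} (ha : 0 ≤ a) (haN : a ≤ N) (hK : 1 ≤ K)
    (hw : 0 ≤ w) (hw1 : w ≤ K) (hu : 0 < u) :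
    ‖hankelKernel a w u‖ ≤ u ^ a * (K * (1 + u)) ^ N * Real.exp (-u) := by
  rw [hankelKernel, norm_mul, Complex.norm_real, Complex.norm_cpow_real, Real.norm_eq_abs,
    abs_of_nonneg (by positivity)]
  have h : ‖1 + ((w * u : ℝ) : ℂ) * Complex.I‖ ^ a ≤ (K * (1 + u)) ^ N := by
    rw [← Real.rpow_natCast]
    exact (Real.rpow_le_rpow (norm_nonneg _) (norm_one_add_mul_I_le hK hw hw1 hu) ha).trans
      (Real.rpow_le_rpow_of_exponent_le (by nlinarith) haN)
  calc _ ≤ Real.exp (-u) * u ^ a * (K * (1 + u)) ^ N := by gcongr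
    _ = _ := by rw [mul_pow]; ring

lemma rpow_le_one_add_pow {a u : ℝ} {N : ℕ} (ha : 0 ≤ a) (haN : a ≤ N) (hu : 0 < u) :
    u ^ a ≤ (1 + u) ^ N := by
  rw [← Real.rpow_natCast]
  exact (Real.rpow_le_rpow hu.le (by linarith) ha).trans
    (Real.rpow_le_rpow_of_exponent_le (by linarith) haN)

lemma norm_hankelKernel_le' {a K w u : ℝ} {N : ℕ} (ha : 0 ≤ a) (haN : a ≤ N) (hK : 1 ≤ K)
    (hw : 0 ≤ w) (hw1 : w ≤ K) (hu : 0 < u) :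
    ‖hankelKernel a w u‖ ≤ K ^ N * (1 + u) ^ (2 * N) * Real.exp (-u) := by
  refine (norm_hankelKernel_le ha haN hK hw hw1 hu).trans ?_
  have := rpow_le_one_add_pow ha haN hu
  calc _ ≤ (1 + u) ^ N * (K * (1 + u)) ^ N * Real.exp (-u) := by gcongr
    _ = _ := by rw [mul_pow]; ring

lemma norm_hankelLog_le {K w u : ℝ} (hK : 1 ≤ K) (hw : 0 ≤ w) (hw1 : w ≤ K) (hu : 0 < u) :
    ‖hankelLog w u‖ ≤ u⁻¹ + 5 * K * (1 + u) := by
  have h1 : |Real.log u| ≤ u⁻¹ + u := by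
    rw [abs_le]
    have := Real.log_le_self hu.le
    have h2 := Real.log_le_self (inv_pos.2 hu).le
    rw [Real.log_inv] at h2
    have : 0 < u⁻¹ := by positivity
    constructor <;> linarith
  have h2 : |Real.log ‖1 + ((w * u : ℝ) : ℂ) * Complex.I‖| ≤ K * (1 + u) := by
    have h := one_le_norm_one_add_mul_I (w * u)
    rw [abs_of_nonneg (Real.log_nonneg h)]
    refine (Real.log_le_sub_one_of_pos (by linarith)).trans ?_
    linarith [norm_one_add_mul_I_le hK hw hw1 hu]
  have h3 := Complex.abs_arg_le_pi (1 + ((w * u : ℝ) : ℂ) * Complex.I)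
  have h4 := Complex.norm_le_abs_re_add_abs_im (Complex.log (1 + ((w * u : ℝ) : ℂ) * Complex.I))
  rw [Complex.log_re, Complex.log_im] at h4
  refine (norm_add_le _ _).trans ?_
  rw [Complex.norm_real, Real.norm_eq_abs]
  nlinarith [Real.pi_le_four]

lemma norm_hankelKernel_mul_hankelLog_le {a K w u : ℝ} {N : ℕ} (ha : 1 ≤ a) (haN : a ≤ N)
    (hK : 1 ≤ K) (hw : 0 ≤ w) (hw1 : w ≤ K) (hu : 0 < u) :
    ‖hankelKernel a w u * hankelLog w u‖ ≤ 6 * K ^ (N + 1) * (1 + u) ^ (2 * N + 1) * Real.exp (-u) := by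
  rw [norm_mul]
  have h1 := norm_hankelKernel_le (by linarith) haN hK hw hw1 hu
  have h2 := norm_hankelLog_le hK hw hw1 hu
  have h3 := rpow_le_one_add_pow (by linarith) haN hu
  have h4 : u ^ a * u⁻¹ ≤ (1 + u) ^ N := by
    rw [← div_eq_mul_inv, ← Real.rpow_sub_one hu.ne']
    exact rpow_le_one_add_pow (by linarith) (by linarith) hu
  have h5 : u ^ a * u⁻¹ ≤ (1 + u) ^ N * (K * (1 + u)) := by
    have : 1 ≤ K * (1 + u) := by nlinarith
    nlinarith [pow_pos (show 0 < 1 + u by linarith) N]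
  have hK0 : 0 < K := by linarith
  calc _ ≤ (u ^ a * (K * (1 + u)) ^ N * Real.exp (-u)) * (u⁻¹ + 5 * K * (1 + u)) := by gcongr
    _ = (u ^ a * u⁻¹ + u ^ a * (5 * K * (1 + u))) * ((K * (1 + u)) ^ N * Real.exp (-u)) := by ring
    _ ≤ ((1 + u) ^ N * (K * (1 + u)) + (1 + u) ^ N * (5 * K * (1 + u)))
        * ((K * (1 + u)) ^ N * Real.exp (-u)) := by gcongr
    _ = _ := by rw [mul_pow]; ring

lemma continuousOn_hankelKernel (a w : ℝ) : ContinuousOn (hankelKernel a w) (Set.Ioi 0) := by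
  intro u hu
  refine ContinuousAt.continuousWithinAt ?_
  unfold hankelKernel
  refine ContinuousAt.mul ?_ ?_
  · refine Complex.continuous_ofReal.continuousAt.comp ?_
    exact (by fun_prop : ContinuousAt (fun u : ℝ => Real.exp (-u)) u).mul
      (Real.continuousAt_rpow_const _ _ (Or.inl hu.ne'))
  · exact ContinuousAt.cpow (by fun_prop) (by fun_prop) (one_add_mul_I_mem_slitPlane _)

lemma continuousOn_hankelLog (w : ℝ) : ContinuousOn (hankelLog w) (Set.Ioi 0) := by
  intro u hu
  refine ContinuousAt.continuousWithinAt ?_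
  unfold hankelLog
  refine ContinuousAt.add ?_ ?_
  · exact Complex.continuous_ofReal.continuousAt.comp (Real.continuousAt_log hu.ne')
  · exact ContinuousAt.clog (by fun_prop) (one_add_mul_I_mem_slitPlane _)

lemma hasDerivAt_hankelKernel (a w : ℝ) {u : ℝ} (hu : 0 < u) :
    HasDerivAt (fun b => hankelKernel b w u) (hankelKernel a w u * hankelLog w u) a := by
  unfold hankelKernel hankelLog
  have h1 : HasDerivAt (fun b : ℝ => ((Real.exp (-u) * u ^ b : ℝ) : ℂ))
      ((Real.exp (-u) * (u ^ a * Real.log u) : ℝ) : ℂ) a :=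
    ((Real.hasStrictDerivAt_const_rpow hu a).hasDerivAt.const_mul _).ofReal_comp
  have h2 : HasDerivAt (fun b : ℝ => (1 + (w * u : ℝ) * Complex.I) ^ (b : ℂ))
      ((1 + (w * u : ℝ) * Complex.I) ^ (a : ℂ) * Complex.log (1 + (w * u : ℝ) * Complex.I) * 1) a :=
    ((hasDerivAt_id (a : ℂ)).const_cpow
      (Or.inl (Complex.slitPlane_ne_zero (one_add_mul_I_mem_slitPlane _)))).comp_ofReal
  refine (h1.mul h2).congr_deriv ?_
  push_cast
  ring

/-- The Hankel-type integral. -/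
noncomputable def hankelInt (a w : ℝ) : ℂ := ∫ u in Set.Ioi (0 : ℝ), hankelKernel a w u

/-- The derivative of `hankelInt` in the exponent. -/
noncomputable def hankelInt' (a w : ℝ) : ℂ :=
  ∫ u in Set.Ioi (0 : ℝ), hankelKernel a w u * hankelLog w u

lemma integrableOn_hankelKernel {a w : ℝ} (ha : 0 ≤ a) (hw : 0 ≤ w) :
    MeasureTheory.IntegrableOn (hankelKernel a w) (Set.Ioi 0) := by
  obtain ⟨N, hN⟩ := exists_nat_ge a
  refine (integrableOn_one_add_pow_mul_exp_neg ((1 + w) ^ N) (2 * N)).mono'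
    ((continuousOn_hankelKernel a w).aestronglyMeasurable measurableSet_Ioi) ?_
  exact MeasureTheory.ae_restrict_of_forall_mem measurableSet_Ioi
    fun u hu => norm_hankelKernel_le' ha hN (by linarith) hw (by linarith) hu

lemma hasDerivAt_hankelInt {a w : ℝ} (ha : 1 < a) (hw : 0 ≤ w) :
    HasDerivAt (fun b => hankelInt b w) (hankelInt' a w) a := by
  obtain ⟨N, hN⟩ := exists_nat_gt a
  refine (hasDerivAt_integral_of_dominated_loc_of_deriv_le (s := Set.Ioo 1 (N : ℝ))
    (bound := fun u => 6 * (1 + w) ^ (N + 1) * (1 + u) ^ (2 * N + 1) * Real.exp (-u))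
    (F' := fun a u => hankelKernel a w u * hankelLog w u) (Ioo_mem_nhds ha hN)
    (Eventually.of_forall fun b =>
      (continuousOn_hankelKernel b w).aestronglyMeasurable measurableSet_Ioi)
    (integrableOn_hankelKernel (by linarith) hw)
    (((continuousOn_hankelKernel a w).mul
      (continuousOn_hankelLog w)).aestronglyMeasurable measurableSet_Ioi) ?_
    (integrableOn_one_add_pow_mul_exp_neg _ _) ?_).2
  · exact MeasureTheory.ae_restrict_of_forall_mem measurableSet_Ioi fun u hu b hb =>
      norm_hankelKernel_mul_hankelLog_le hb.1.le hb.2.le (by linarith) hw (by linarith) hu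
  · exact MeasureTheory.ae_restrict_of_forall_mem measurableSet_Ioi fun u hu b _ =>
      hasDerivAt_hankelKernel b w hu

lemma continuousAt_hankelKernel_right (a w u : ℝ) :
    ContinuousAt (fun w => hankelKernel a w u) w := by
  unfold hankelKernel
  exact continuousAt_const.mul
    (ContinuousAt.cpow (by fun_prop) (by fun_prop) (one_add_mul_I_mem_slitPlane _))

lemma continuousAt_hankelLog_right (w u : ℝ) : ContinuousAt (fun w => hankelLog w u) w := by
  unfold hankelLog
  exact continuousAt_const.add
    (ContinuousAt.clog (by fun_prop) (one_add_mul_I_mem_slitPlane _))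

open Topology in
lemma tendsto_hankelInt {a : ℝ} (ha : 1 ≤ a) :
    Tendsto (hankelInt a) (𝓝[>] 0) (𝓝 (hankelInt a 0)) := by
  obtain ⟨N, hN⟩ := exists_nat_gt a
  refine MeasureTheory.tendsto_integral_filter_of_dominated_convergence
    (fun u => 1 ^ N * (1 + u) ^ (2 * N) * Real.exp (-u)) (Eventually.of_forall fun w =>
      (continuousOn_hankelKernel a w).aestronglyMeasurable measurableSet_Ioi) ?_
    (integrableOn_one_add_pow_mul_exp_neg _ _) ?_
  · filter_upwards [Ioo_mem_nhdsGT (show (0 : ℝ) < 1 by norm_num)] with w hw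
    exact MeasureTheory.ae_restrict_of_forall_mem measurableSet_Ioi fun u hu =>
      norm_hankelKernel_le' (by linarith) hN.le le_rfl hw.1.le hw.2.le hu
  · exact Eventually.of_forall fun u =>
      (continuousAt_hankelKernel_right a 0 u).tendsto.mono_left nhdsWithin_le_nhds

open Topology in
lemma tendsto_hankelInt' {a : ℝ} (ha : 1 ≤ a) :
    Tendsto (hankelInt' a) (𝓝[>] 0) (𝓝 (hankelInt' a 0)) := by
  obtain ⟨N, hN⟩ := exists_nat_gt a
  refine MeasureTheory.tendsto_integral_filter_of_dominated_convergence
    (fun u => 6 * 1 ^ (N + 1) * (1 + u) ^ (2 * N + 1) * Real.exp (-u)) (Eventually.of_forall fun w =>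
      ((continuousOn_hankelKernel a w).mul
      (continuousOn_hankelLog w)).aestronglyMeasurable measurableSet_Ioi) ?_
    (integrableOn_one_add_pow_mul_exp_neg _ _) ?_
  · filter_upwards [Ioo_mem_nhdsGT (show (0 : ℝ) < 1 by norm_num)] with w hw
    exact MeasureTheory.ae_restrict_of_forall_mem measurableSet_Ioi fun u hu =>
      norm_hankelKernel_mul_hankelLog_le ha hN.le le_rfl hw.1.le hw.2.le hu
  · exact Eventually.of_forall fun u => ((continuousAt_hankelKernel_right a 0 u).mul
      (continuousAt_hankelLog_right 0 u)).tendsto.mono_left nhdsWithin_le_nhds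

lemma hankelInt_zero {a : ℝ} (ha : 0 ≤ a) : hankelInt a 0 = Real.Gamma (a + 1) := by
  rw [hankelInt, Real.Gamma_eq_integral (by linarith), ← integral_complex_ofReal]
  refine MeasureTheory.setIntegral_congr_fun measurableSet_Ioi fun u _ => ?_
  simp [hankelKernel]

lemma one_sub_one_add_mul_I_sq_cpow (a : ℝ) {y : ℝ} (hy : 0 < y) :
    (1 - (1 + (y : ℂ) * Complex.I) ^ 2) ^ (a : ℂ)
      = Complex.exp (-(π * a / 2 : ℝ) * Complex.I) * ((2 * y) ^ a : ℝ)
        * (1 + ((y / 2 : ℝ) : ℂ) * Complex.I) ^ (a : ℂ) := by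
  have hne := Complex.slitPlane_ne_zero (one_add_mul_I_mem_slitPlane (y / 2))
  have e : 1 - (1 + (y : ℂ) * Complex.I) ^ 2
      = ((2 * y : ℝ) : ℂ) * (-Complex.I * (1 + ((y / 2 : ℝ) : ℂ) * Complex.I)) := by
    push_cast
    linear_combination (-(y : ℂ) ^ 2 + (y : ℂ) ^ 2) * Complex.I_sq
  have h1 : Complex.log (-Complex.I * (1 + ((y / 2 : ℝ) : ℂ) * Complex.I))
      = -(π / 2) * Complex.I + Complex.log (1 + ((y / 2 : ℝ) : ℂ) * Complex.I) := by
    rw [Complex.log_mul (by simp) hne, Complex.log_neg_I]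
    rw [Complex.arg_neg_I]
    have h2 : 0 ≤ Complex.arg (1 + ((y / 2 : ℝ) : ℂ) * Complex.I) := by
      rw [Complex.arg_nonneg_iff]; simp; linarith
    have h3 := Complex.arg_le_pi (1 + ((y / 2 : ℝ) : ℂ) * Complex.I)
    constructor <;> linarith [Real.pi_pos]
  have hm : -Complex.I * (1 + ((y / 2 : ℝ) : ℂ) * Complex.I) ≠ 0 := mul_ne_zero (by simp) hne
  have h2y : (0 : ℝ) < 2 * y := by linarith
  rw [e, Complex.cpow_def_of_ne_zero (mul_ne_zero (by exact_mod_cast h2y.ne') hm),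
    Complex.log_ofReal_mul h2y hm, h1, Complex.cpow_def_of_ne_zero hne,
    Real.rpow_def_of_pos h2y, Complex.ofReal_exp, ← Complex.exp_add, ← Complex.exp_add]
  congr 1
  push_cast
  ring

lemma contour_right_eq_hankelKernel (a : ℝ) {x y : ℝ} (hx : 0 < x) (hy : 0 < y) :
    (1 - (1 + (y : ℂ) * Complex.I) ^ 2) ^ (a : ℂ)
        * Complex.exp (Complex.I * x * (1 + (y : ℂ) * Complex.I))
      = Complex.exp ((x - π * a / 2 : ℝ) * Complex.I) * ((2 / x) ^ a : ℝ)
        * hankelKernel a (1 / (2 * x)) (x * y) := by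
  rw [one_sub_one_add_mul_I_sq_cpow a hy, hankelKernel,
    show 1 / (2 * x) * (x * y) = y / 2 by field_simp,
    show 2 * y = 2 / x * (x * y) by field_simp,
    Real.mul_rpow (by positivity) (by positivity)]
  have e : Complex.exp (-(π * a / 2 : ℝ) * Complex.I)
      * Complex.exp (Complex.I * x * (1 + (y : ℂ) * Complex.I))
      = Complex.exp ((x - π * a / 2 : ℝ) * Complex.I) * (Real.exp (-(x * y)) : ℝ) := by
    rw [Complex.ofReal_exp, ← Complex.exp_add, ← Complex.exp_add]
    congr 1
    push_cast
    linear_combination (x : ℂ) * y * Complex.I_sq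
  rw [Complex.ofReal_mul, Complex.ofReal_mul]
  linear_combination ((2 / x) ^ a : ℝ) * ((x * y) ^ a : ℝ)
    * (1 + ((y / 2 : ℝ) : ℂ) * Complex.I) ^ (a : ℂ) * e

/-- The integrand of the contour integral connecting Poisson's and Hankel's representations. -/
noncomputable def contourFun (a x : ℝ) (z : ℂ) : ℂ :=
  (1 - z ^ 2) ^ (a : ℂ) * Complex.exp (Complex.I * x * z)

lemma continuousAt_contourFun {a x : ℝ} (ha : 0 < a) {z : ℂ} (h0 : 0 ≤ z.re) (h1 : z.re ≤ 1) :
    ContinuousAt (contourFun a x) z := by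
  unfold contourFun
  refine ContinuousAt.mul ?_ (by fun_prop)
  have h : ContinuousAt (fun w : ℂ => w ^ (a : ℂ)) (1 - z ^ 2) := by
    refine Complex.continuousAt_cpow_const_of_re_pos (Or.inl ?_) (by simpa using ha)
    simp [pow_two]; nlinarith [mul_self_nonneg z.im]
  exact ContinuousAt.comp (f := fun z : ℂ => 1 - z ^ 2) h (by fun_prop)

lemma differentiableAt_contourFun {a x : ℝ} {z : ℂ} (h0 : 0 ≤ z.re) (h1 : z.re < 1) :
    DifferentiableAt ℂ (contourFun a x) z := by
  unfold contourFun
  refine DifferentiableAt.mul ?_ (by fun_prop)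
  refine DifferentiableAt.cpow (by fun_prop) (by fun_prop) (Or.inl ?_)
  simp [pow_two]; nlinarith [mul_self_nonneg z.im]

lemma contourFun_rect {a x R : ℝ} (ha : 0 < a) :
    (∫ t : ℝ in 0..1, contourFun a x t) - (∫ t : ℝ in 0..1, contourFun a x (t + R * Complex.I))
      + Complex.I * (∫ y : ℝ in 0..R, contourFun a x (1 + y * Complex.I))
      - Complex.I * (∫ y : ℝ in 0..R, contourFun a x (y * Complex.I)) = 0 := by
  have h := Complex.integral_boundary_rect_eq_zero_of_continuousOn_of_differentiableOn
    (contourFun a x) 0 (1 + R * Complex.I) ?_ ?_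
  · simpa using h
  · intro z hz
    simp [Complex.mem_reProdIm] at hz
    exact (continuousAt_contourFun ha hz.1.1 hz.1.2).continuousWithinAt
  · intro z hz
    simp [Complex.mem_reProdIm] at hz
    exact (differentiableAt_contourFun hz.1.1.le hz.1.2).differentiableWithinAt

open Topology in
lemma tendsto_contourFun_top {a x : ℝ} (ha : 0 < a) (hx : 0 < x) :
    Tendsto (fun R : ℝ => ∫ t : ℝ in 0..1, contourFun a x (t + R * Complex.I)) atTop (𝓝 0) := by
  refine squeeze_zero_norm' ?_ (tendsto_rpow_mul_exp_neg_mul_atTop_nhds_zero (3 * a) x hx)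
  filter_upwards [eventually_ge_atTop 2] with R hR
  refine (intervalIntegral.norm_integral_le_of_norm_le_const
    (C := R ^ (3 * a) * Real.exp (-x * R)) fun t ht => ?_).trans (by simp)
  rw [Set.uIoc_of_le zero_le_one] at ht
  rw [contourFun, norm_mul, Complex.norm_cpow_real, Complex.norm_exp]
  have h1 : ‖1 - ((t : ℂ) + R * Complex.I) ^ 2‖ ≤ R ^ 3 := by
    refine (norm_sub_le _ _).trans ?_
    rw [norm_pow, ← Complex.normSq_eq_norm_sq, Complex.normSq_add_mul_I]
    simp only [norm_one]
    nlinarith [ht.1, ht.2]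
  have h2 : (R : ℝ) ^ (3 * a) = (R ^ 3) ^ a := by
    rw [Real.rpow_mul (by linarith)]; norm_cast
  rw [h2]
  gcongr
  simp

lemma im_integral_contourFun_left (a x R : ℝ) :
    (∫ y : ℝ in 0..R, contourFun a x (y * Complex.I)).im = 0 := by
  have : ∀ y : ℝ, contourFun a x (y * Complex.I)
      = (((1 + y ^ 2) ^ a * Real.exp (-(x * y)) : ℝ) : ℂ) := by
    intro y
    rw [contourFun, show 1 - ((y : ℂ) * Complex.I) ^ 2 = ((1 + y ^ 2 : ℝ) : ℂ) by
      push_cast; linear_combination -(y : ℂ) ^ 2 * Complex.I_sq,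
      ← Complex.ofReal_cpow (by positivity)]
    push_cast
    congr 2
    linear_combination (x : ℂ) * y * Complex.I_sq
  simp only [this]
  rw [intervalIntegral.integral_ofReal, Complex.ofReal_im]

open MeasureTheory Set in
lemma re_integral_contourFun_bottom {a : ℝ} (ha : 0 < a) (x : ℝ) :
    (∫ t : ℝ in 0..1, contourFun a x t).re
      = ∫ t in Ioo (0 : ℝ) 1, (1 - t ^ 2) ^ a * Real.cos (x * t) := by
  have hc : IntervalIntegrable (fun t : ℝ => contourFun a x t) volume 0 1 := by
    refine ContinuousOn.intervalIntegrable fun t ht => ?_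
    rw [uIcc_of_le zero_le_one] at ht
    exact ((continuousAt_contourFun ha (by simpa using ht.1) (by simpa using ht.2)).comp
      Complex.continuous_ofReal.continuousAt).continuousWithinAt
  have h := Complex.reCLM.intervalIntegral_comp_comm hc
  rw [Complex.reCLM_apply] at h
  rw [← h, intervalIntegral.integral_of_le zero_le_one, integral_Ioc_eq_integral_Ioo]
  refine setIntegral_congr_fun measurableSet_Ioo fun t ht => ?_
  simp only [Complex.reCLM_apply, contourFun]
  rw [show 1 - (t : ℂ) ^ 2 = ((1 - t ^ 2 : ℝ) : ℂ) by push_cast; rfl,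
    ← Complex.ofReal_cpow (by nlinarith [ht.1, ht.2]), Complex.re_ofReal_mul,
    show Complex.I * x * t = ((x * t : ℝ) : ℂ) * Complex.I by push_cast; ring,
    Complex.exp_ofReal_mul_I_re]

open MeasureTheory Set Topology in
lemma tendsto_contourFun_right {a x : ℝ} (ha : 0 < a) (hx0 : 0 < x) :
    Tendsto (fun R : ℝ => ∫ y : ℝ in 0..R, contourFun a x (1 + y * Complex.I)) atTop
      (𝓝 (Complex.exp ((x - π * a / 2 : ℝ) * Complex.I) * ((2 / x) ^ a * x⁻¹ : ℝ)
        * hankelInt a (1 / (2 * x)))) := by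
  have hE : EqOn (fun y : ℝ => contourFun a x (1 + y * Complex.I))
      (fun y => Complex.exp ((x - π * a / 2 : ℝ) * Complex.I) * ((2 / x) ^ a : ℝ)
        * hankelKernel a (1 / (2 * x)) (x * y)) (Ioi 0) :=
    fun y hy => contour_right_eq_hankelKernel a hx0 hy
  have hI : IntegrableOn (fun y => hankelKernel a (1 / (2 * x)) (x * y)) (Ioi 0) := by
    rw [integrableOn_Ioi_comp_mul_left_iff _ _ hx0, mul_zero]
    exact integrableOn_hankelKernel ha.le (by positivity)
  have hI2 : IntegrableOn (fun y : ℝ => contourFun a x (1 + y * Complex.I)) (Ioi 0) :=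
    (integrableOn_congr_fun hE measurableSet_Ioi).2 (hI.const_mul _)
  have h := intervalIntegral_tendsto_integral_Ioi 0 hI2 tendsto_id
  rw [setIntegral_congr_fun measurableSet_Ioi hE, integral_const_mul,
    integral_comp_mul_left_Ioi _ _ hx0, mul_zero] at h
  refine h.trans_eq (congrArg _ ?_)
  rw [Complex.real_smul, ← hankelInt, Complex.ofReal_mul]
  ring

open MeasureTheory Set in
lemma integral_poisson_eq_hankelInt {a x : ℝ} (ha : 0 < a) (hx0 : 0 < x) :
    ∫ t in Ioo (0 : ℝ) 1, (1 - t ^ 2) ^ a * Real.cos (x * t)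
      = (Complex.exp ((x - π * a / 2 : ℝ) * Complex.I) * ((2 / x) ^ a * x⁻¹ : ℝ)
        * hankelInt a (1 / (2 * x))).im := by
  have h1 := (Complex.continuous_re.tendsto _).comp (tendsto_contourFun_top ha hx0)
  have h2 := (Complex.continuous_im.tendsto _).comp (tendsto_contourFun_right ha hx0)
  have h3 := h1.add h2
  rw [Complex.zero_re, zero_add] at h3
  refine tendsto_nhds_unique ?_ h3
  refine tendsto_const_nhds.congr fun R => ?_
  have h := congrArg Complex.re (contourFun_rect (x := x) (R := R) ha)
  simp only [Complex.add_re, Complex.sub_re, Complex.I_mul_re, Complex.zero_re,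
    im_integral_contourFun_left a x R, re_integral_contourFun_bottom ha x] at h
  simp only [Function.comp]
  linarith

/-- Hankel's representation of `J_ν`. -/
lemma sqrt_mul_besselJ_eq {ν x : ℝ} (hν : 1 / 2 < ν) (hx0 : 0 < x) :
    √x * besselJ ν x = √(2 / π) * (Complex.exp ((x - ν * π / 2 - π / 4 : ℝ) * Complex.I)
      * (hankelInt (ν - 1 / 2) (1 / (2 * x)) / (Real.Gamma (ν + 1 / 2) : ℂ))).re := by
  rw [besselJ_eq_poisson (by linarith) hx0, integral_poisson_eq_hankelInt (by linarith) hx0]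
  have hg := Real.Gamma_pos_of_pos (show 0 < ν + 1 / 2 by linarith)
  generalize Real.Gamma (ν + 1 / 2) = g at hg ⊢
  generalize hankelInt (ν - 1 / 2) (1 / (2 * x)) = H
  set θ := x - ν * π / 2 - π / 4 with hθ
  have e1 : Complex.exp ((x - π * (ν - 1 / 2) / 2 : ℝ) * Complex.I)
      = Complex.exp (θ * Complex.I) * Complex.I := by
    rw [show x - π * (ν - 1 / 2) / 2 = θ + π / 2 by rw [hθ]; ring, Complex.ofReal_add, add_mul,
      Complex.exp_add]
    push_cast
    rw [Complex.exp_pi_div_two_mul_I]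
  have e2 : ∀ c : ℝ, (Complex.exp ((x - π * (ν - 1 / 2) / 2 : ℝ) * Complex.I) * (c : ℂ) * H).im
      = c * (Complex.exp (θ * Complex.I) * H).re := by
    intro c
    rw [e1, show Complex.exp (θ * Complex.I) * Complex.I * (c : ℂ) * H
      = (c : ℂ) * (Complex.I * (Complex.exp (θ * Complex.I) * H)) by ring, Complex.im_ofReal_mul,
      Complex.I_mul_im]
  rw [e2, ← mul_div_assoc, Complex.div_ofReal_re]
  generalize (Complex.exp (θ * Complex.I) * H).re = r
  have e3 : (2 / x) ^ (ν - 1 / 2) = √x / √2 / (x / 2) ^ ν := by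
    rw [← Real.sqrt_div hx0.le, ← inv_div x 2, Real.inv_rpow (by positivity),
      Real.rpow_sub (by positivity), ← Real.sqrt_eq_rpow, inv_div]
  have h2 : √2 ^ 2 = 2 := Real.sq_sqrt (by norm_num)
  have hsx : √x ^ 2 = x := Real.sq_sqrt hx0.le
  have hp : 0 < (x / 2) ^ ν := by positivity
  generalize (x / 2) ^ ν = P at hp e3 ⊢
  rw [e3, Real.sqrt_div (by norm_num)]
  have : √π ≠ 0 := by positivity
  field_simp
  rw [h2, hsx]
  ring

/-- The amplitude factor `G` in `√x J_ν(x) = √(2/π) Re (e^{iφ} G(ν, 1 / (2 * x)))`. -/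
noncomputable def hankelAmp (ν w : ℝ) : ℂ :=
  hankelInt (ν - 1 / 2) w / (Real.Gamma (ν + 1 / 2) : ℂ)

/-- The derivative of `hankelAmp` in the order. -/
noncomputable def hankelAmp' (ν w : ℝ) : ℂ :=
  (hankelInt' (ν - 1 / 2) w * (Real.Gamma (ν + 1 / 2) : ℂ)
    - hankelInt (ν - 1 / 2) w * ((deriv Real.Gamma (ν + 1 / 2) : ℝ) : ℂ))
      / (Real.Gamma (ν + 1 / 2) : ℂ) ^ 2

lemma hasDerivAt_hankelAmp {ν w : ℝ} (hν : 3 / 2 < ν) (hw : 0 ≤ w) :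
    HasDerivAt (fun μ => hankelAmp μ w) (hankelAmp' ν w) ν := by
  have h1 : HasDerivAt (fun μ => hankelInt (μ - 1 / 2) w) (hankelInt' (ν - 1 / 2) w) ν :=
    (hasDerivAt_hankelInt (a := ν - 1 / 2) (by linarith) hw).comp_sub_const ν (1 / 2)
  have h2 : HasDerivAt Real.Gamma (deriv Real.Gamma (ν + 1 / 2)) (ν + 1 / 2) := by
    refine (Real.differentiableAt_Gamma fun m => ?_).hasDerivAt
    have : (0 : ℝ) ≤ m := by positivity
    linarith
  refine h1.div (h2.comp_add_const ν (1 / 2)).ofReal_comp ?_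
  exact_mod_cast (Real.Gamma_pos_of_pos (show 0 < ν + 1 / 2 by linarith)).ne'

lemma hankelAmp_zero {ν : ℝ} (hν : 1 / 2 ≤ ν) : hankelAmp ν 0 = 1 := by
  rw [hankelAmp, hankelInt_zero (by linarith), show ν - 1 / 2 + 1 = ν + 1 / 2 by ring]
  refine div_self ?_
  exact_mod_cast (Real.Gamma_pos_of_pos (show 0 < ν + 1 / 2 by linarith)).ne'

lemma hankelAmp'_zero {ν : ℝ} (hν : 3 / 2 < ν) : hankelAmp' ν 0 = 0 := by
  have h := hasDerivAt_hankelAmp hν le_rfl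
  refine h.unique ((hasDerivAt_const ν (1 : ℂ)).congr_of_eventuallyEq ?_)
  filter_upwards [lt_mem_nhds hν] with μ hμ
  exact hankelAmp_zero (by linarith)

lemma tendsto_one_div_two_mul_atTop :
    Tendsto (fun x : ℝ => 1 / (2 * x)) atTop (nhdsWithin 0 (Set.Ioi 0)) := by
  have := tendsto_inv_atTop_nhdsGT_zero.comp
    ((tendsto_id (α := ℝ) (x := atTop)).const_mul_atTop (show (0 : ℝ) < 2 by norm_num))
  refine this.congr fun x => ?_
  simp

open Topology in
lemma tendsto_hankelAmp {ν : ℝ} (hν : 3 / 2 < ν) :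
    Tendsto (fun x : ℝ => hankelAmp ν (1 / (2 * x))) atTop (𝓝 1) := by
  rw [← hankelAmp_zero (show 1 / 2 ≤ ν by linarith)]
  have h := (tendsto_hankelInt (a := ν - 1 / 2) (by linarith)).comp tendsto_one_div_two_mul_atTop
  exact h.div_const _

open Topology in
lemma tendsto_hankelAmp' {ν : ℝ} (hν : 3 / 2 < ν) :
    Tendsto (fun x : ℝ => hankelAmp' ν (1 / (2 * x))) atTop (𝓝 0) := by
  rw [← hankelAmp'_zero hν]
  have h := (tendsto_hankelInt (a := ν - 1 / 2) (by linarith)).comp tendsto_one_div_two_mul_atTop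
  have h' := (tendsto_hankelInt' (a := ν - 1 / 2) (by linarith)).comp tendsto_one_div_two_mul_atTop
  exact ((h'.mul_const _).sub (h.mul_const _)).div_const _

/-- The phase `x - νπ/2 - π/4`. -/
noncomputable def besselPhase (ν x : ℝ) : ℝ := x - ν * π / 2 - π / 4

open Topology in
/-- Leading-order asymptotics of `J_ν` and of its derivative in the order. -/
structure BesselJAsymp (ν : ℝ) : Prop where
  differentiableAt : ∀ x, 0 < x → DifferentiableAt ℝ (fun μ => besselJ μ x) ν
  tendsto : Tendsto (fun x => √x * besselJ ν x - √(2 / π) * Real.cos (besselPhase ν x)) atTop (𝓝 0)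
  tendsto_deriv : Tendsto (fun x => √x * deriv (fun μ => besselJ μ x) ν
    - √(2 / π) * (π / 2) * Real.sin (besselPhase ν x)) atTop (𝓝 0)

lemma hasDerivAt_besselJ_order {ν x : ℝ} (hν : 3 / 2 < ν) (hx : 0 < x) :
    HasDerivAt (fun μ => besselJ μ x) (√(2 / π) / √x *
      (Complex.exp (besselPhase ν x * Complex.I)
        * (-(π / 2) * Complex.I * hankelAmp ν (1 / (2 * x))
          + hankelAmp' ν (1 / (2 * x)))).re) ν := by
  have hp : HasDerivAt (fun μ => besselPhase μ x) (-(π / 2)) ν := by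
    unfold besselPhase
    have := ((((hasDerivAt_id ν).mul_const π).div_const 2).const_sub x).sub_const (π / 4)
    exact this.congr_deriv (by ring)
  have h1 := ((hp.ofReal_comp.mul_const Complex.I).cexp.mul
    (hasDerivAt_hankelAmp (w := 1 / (2 * x)) hν (by positivity)))
  have h2 := (Complex.reCLM.hasFDerivAt.comp_hasDerivAt ν h1).const_mul (√(2 / π) / √x)
  have hsx : √x ≠ 0 := (Real.sqrt_pos.2 hx).ne'
  refine (h2.congr_deriv ?_).congr_of_eventuallyEq ?_
  · simp only [Complex.reCLM_apply]
    congr 2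
    push_cast
    ring
  · filter_upwards [lt_mem_nhds hν] with μ hμ
    have := sqrt_mul_besselJ_eq (ν := μ) (by linarith) hx
    simp only [Function.comp, Complex.reCLM_apply, Pi.mul_apply]
    rw [div_mul_eq_mul_div, eq_div_iff hsx, mul_comm, this]
    rfl

open Topology in
lemma besselJAsymp_of_gt {ν : ℝ} (hν : 3 / 2 < ν) : BesselJAsymp ν where
  differentiableAt x hx := (hasDerivAt_besselJ_order hν hx).differentiableAt
  tendsto := by
    have h : Tendsto (fun x : ℝ => √(2 / π) * ‖hankelAmp ν (1 / (2 * x)) - 1‖) atTop (𝓝 0) := by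
      simpa using ((tendsto_hankelAmp hν).sub_const 1).norm.const_mul (√(2 / π))
    refine squeeze_zero_norm' ?_ h
    filter_upwards [eventually_gt_atTop 0] with x hx
    rw [sqrt_mul_besselJ_eq (by linarith) hx, ← Complex.exp_ofReal_mul_I_re, ← mul_sub, norm_mul,
      Real.norm_of_nonneg (Real.sqrt_nonneg _), ← Complex.sub_re]
    gcongr
    refine (Complex.abs_re_le_norm _).trans ?_
    change ‖Complex.exp (besselPhase ν x * Complex.I) * hankelAmp ν (1 / (2 * x)) - _‖ ≤ _
    rw [← mul_sub_one, norm_mul, Complex.norm_exp_ofReal_mul_I, one_mul]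
  tendsto_deriv := by
    have h : Tendsto (fun x : ℝ => √(2 / π) * (π / 2 * ‖hankelAmp ν (1 / (2 * x)) - 1‖
        + ‖hankelAmp' ν (1 / (2 * x))‖)) atTop (𝓝 0) := by
      simpa using ((((tendsto_hankelAmp hν).sub_const 1).norm.const_mul (π / 2)).add
        (tendsto_hankelAmp' hν).norm).const_mul (√(2 / π))
    refine squeeze_zero_norm' ?_ h
    filter_upwards [eventually_gt_atTop 0] with x hx
    have hsx : √x ≠ 0 := (Real.sqrt_pos.2 hx).ne'
    have e : π / 2 * Real.sin (besselPhase ν x)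
        = (Complex.exp (besselPhase ν x * Complex.I) * (-(π / 2) * Complex.I)).re := by
      rw [show Complex.exp (besselPhase ν x * Complex.I) * (-(π / 2) * Complex.I)
        = ((-(π / 2) : ℝ) : ℂ) * (Complex.I * Complex.exp (besselPhase ν x * Complex.I)) by
          push_cast; ring, Complex.re_ofReal_mul, Complex.I_mul_re, Complex.exp_ofReal_mul_I_im]
      ring
    rw [(hasDerivAt_besselJ_order hν hx).deriv, mul_assoc (√(2 / π)), e, ← mul_assoc (√x),
      mul_div_cancel₀ _ hsx, ← mul_sub, norm_mul,
      Real.norm_of_nonneg (Real.sqrt_nonneg _), ← Complex.sub_re]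
    gcongr
    refine (Complex.abs_re_le_norm _).trans ?_
    rw [← mul_sub, norm_mul, Complex.norm_exp_ofReal_mul_I, one_mul,
      show ∀ G G' : ℂ, -(π / 2) * Complex.I * G + G' - -(π / 2) * Complex.I
        = -(π / 2) * Complex.I * (G - 1) + G' by intros; ring]
    refine (norm_add_le _ _).trans ?_
    rw [norm_mul, norm_mul, Complex.norm_I, norm_neg, mul_one]
    have : ‖(π / 2 : ℂ)‖ = π / 2 := by
      rw [show (π / 2 : ℂ) = ((π / 2 : ℝ) : ℂ) by push_cast; rfl, Complex.norm_real,
        Real.norm_of_nonneg (by positivity)]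
    rw [this]

open Topology in
lemma tendsto_div_of_tendsto_sub_zero {f g : ℝ → ℝ} {C : ℝ} (hg : ∀ x, |g x| ≤ C)
    (h : Tendsto (fun x => f x - g x) atTop (𝓝 0)) : Tendsto (fun x => f x / x) atTop (𝓝 0) := by
  have h1 : Tendsto (fun x => (f x - g x) * x⁻¹) atTop (𝓝 (0 * 0)) := h.mul tendsto_inv_atTop_zero
  have h2 : Tendsto (fun x : ℝ => g x * x⁻¹) atTop (𝓝 0) :=
    bdd_le_mul_tendsto_zero' C (Eventually.of_forall hg) tendsto_inv_atTop_zero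
  have := h1.add h2
  rw [zero_mul, zero_add] at this
  refine this.congr fun x => ?_
  ring

lemma abs_const_mul_cos_le (c t : ℝ) : |c * Real.cos t| ≤ |c| := by
  rw [abs_mul]; exact mul_le_of_le_one_right (abs_nonneg _) (Real.abs_cos_le_one _)

lemma abs_const_mul_sin_le (c t : ℝ) : |c * Real.sin t| ≤ |c| := by
  rw [abs_mul]; exact mul_le_of_le_one_right (abs_nonneg _) (Real.abs_sin_le_one _)

lemma besselPhase_add_one (ν x : ℝ) : besselPhase (ν + 1) x = besselPhase ν x - π / 2 := by
  unfold besselPhase; ring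

lemma besselPhase_sub_one (ν x : ℝ) : besselPhase (ν - 1) x = besselPhase ν x + π / 2 := by
  unfold besselPhase; ring

lemma BesselJAsymp.sub_one {ν : ℝ} (h0 : BesselJAsymp ν) (h1 : BesselJAsymp (ν + 1)) :
    BesselJAsymp (ν - 1) := by
  have hd : ∀ x, 0 < x → HasDerivAt (fun μ => besselJ μ x)
      (2 / x * besselJ ν x + 2 * ν / x * deriv (fun μ => besselJ μ x) ν
        - deriv (fun μ => besselJ μ x) (ν + 1)) (ν - 1) := by
    intro x hx
    have e0 := (h0.differentiableAt x hx).hasDerivAt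
    have e1 := (h1.differentiableAt x hx).hasDerivAt
    have e2 : HasDerivAt (fun μ => besselJ (μ - 1) x)
        (2 / x * besselJ ν x + 2 * ν / x * deriv (fun μ => besselJ μ x) ν
        - deriv (fun μ => besselJ μ x) (ν + 1)) ν := by
      have := ((((hasDerivAt_id ν).const_mul 2).div_const x).mul e0).sub
        (e1.comp_add_const ν 1)
      refine (this.congr_deriv (by simp)).congr_of_eventuallyEq ?_
      exact Eventually.of_forall fun μ => besselJ_sub_one μ hx
    have e3 := HasDerivAt.comp_add_const (f := fun μ => besselJ (μ - 1) x) (ν - 1) 1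
      (by simpa using e2)
    simpa using e3
  have b0 := tendsto_div_of_tendsto_sub_zero (fun x => abs_const_mul_cos_le _ _) h0.tendsto
  have b1 := tendsto_div_of_tendsto_sub_zero (fun x => abs_const_mul_sin_le _ _) h0.tendsto_deriv
  refine ⟨fun x hx => (hd x hx).differentiableAt, ?_, ?_⟩
  · have := (b0.const_mul (2 * ν)).sub h1.tendsto
    rw [mul_zero, sub_zero] at this
    refine this.congr' ?_
    filter_upwards [eventually_gt_atTop 0] with x hx
    rw [besselJ_sub_one ν hx, besselPhase_add_one, besselPhase_sub_one, Real.cos_sub_pi_div_two,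
      Real.cos_add_pi_div_two]
    ring
  · have := ((b0.const_mul 2).add (b1.const_mul (2 * ν))).sub h1.tendsto_deriv
    rw [mul_zero, mul_zero, add_zero, sub_zero] at this
    refine this.congr' ?_
    filter_upwards [eventually_gt_atTop 0] with x hx
    rw [(hd x hx).deriv, besselPhase_add_one, besselPhase_sub_one, Real.sin_sub_pi_div_two,
      Real.sin_add_pi_div_two]
    ring

lemma besselJAsymp (ν : ℝ) : BesselJAsymp ν := by
  have h : ∀ n : ℕ, ∀ ν : ℝ, 3 / 2 < ν + n → BesselJAsymp ν ∧ BesselJAsymp (ν + 1) := by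
    intro n
    induction n with
    | zero => exact fun ν hν =>
        ⟨besselJAsymp_of_gt (by simpa using hν), besselJAsymp_of_gt (by simp at hν; linarith)⟩
    | succ n ih =>
      intro ν hν
      obtain ⟨h0, h1⟩ := ih (ν + 1) (by push_cast at hν; linarith)
      exact ⟨by simpa using h0.sub_one h1, h0⟩
  obtain ⟨n, hn⟩ := exists_nat_gt (3 / 2 - ν)
  exact (h n ν (by linarith)).1

/-- The expression whose limit in the order defines `Y_ν`. -/
noncomputable def besselQ (ν x : ℝ) : ℝ :=
  (besselJ ν x * Real.cos (ν * π) - besselJ (-ν) x) / Real.sin (ν * π)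

/-- The set of non-integers. -/
abbrev nonInt : Set ℝ := {μ : ℝ | ∀ n : ℤ, μ ≠ (n : ℝ)}

lemma sin_mul_pi_ne_zero {ν : ℝ} (hν : ν ∈ nonInt) : Real.sin (ν * π) ≠ 0 := by
  intro h
  obtain ⟨n, hn⟩ := Real.sin_eq_zero_iff.1 h
  exact hν n (mul_right_cancel₀ Real.pi_ne_zero hn).symm

lemma nhdsWithin_nonInt_neBot (μ : ℝ) : (nhdsWithin μ nonInt).NeBot := by
  have : (nonInt : Set ℝ) = (Set.range ((↑) : ℤ → ℝ))ᶜ := by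
    ext x; simp [nonInt, eq_comm]
  rw [this]
  exact mem_closure_iff_nhdsWithin_neBot.1
    ((Set.countable_range ((↑) : ℤ → ℝ)).dense_compl ℝ μ)

lemma cos_int_mul_pi_sq (n : ℤ) : Real.cos (n * π) * Real.cos (n * π) = 1 := by
  rw [← pow_two, Real.cos_sq', Real.sin_int_mul_pi]; norm_num

lemma besselJ_neg_nat (n : ℕ) {x : ℝ} (hx : 0 < x) :
    besselJ (-(n : ℝ)) x = Real.cos (n * π) * besselJ n x := by
  induction n using Nat.twoStepInduction with
  | zero => simp
  | one =>
    have := besselJ_sub_one 0 hx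
    simpa using this
  | more n h0 h1 =>
    have e1 := besselJ_sub_one (-((n + 1 : ℕ) : ℝ)) hx
    have e2 := besselJ_sub_one ((n + 1 : ℕ) : ℝ) hx
    push_cast at *
    rw [show -((n : ℝ) + 1) - 1 = -((n : ℝ) + 2) by ring,
      show -((n : ℝ) + 1) + 1 = -(n : ℝ) by ring] at e1
    rw [show (n : ℝ) + 1 - 1 = n by ring, show (n : ℝ) + 1 + 1 = n + 2 by ring] at e2
    rw [show ((n : ℝ) + 1) * π = n * π + π by ring, Real.cos_add_pi] at h1
    rw [show ((n : ℝ) + 2) * π = n * π + 2 * π by ring, Real.cos_add_two_pi, e1, h0, h1, e2]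
    ring

lemma besselJ_neg_int (n : ℤ) {x : ℝ} (hx : 0 < x) :
    besselJ (-(n : ℝ)) x = Real.cos (n * π) * besselJ n x := by
  obtain ⟨m, rfl | rfl⟩ := n.eq_nat_or_neg
  · exact_mod_cast besselJ_neg_nat m hx
  · have h := besselJ_neg_nat m hx
    have h2 := cos_int_mul_pi_sq m
    push_cast at *
    rw [neg_neg, neg_mul, Real.cos_neg, h, ← mul_assoc, h2, one_mul]

open Topology in
lemma tendsto_besselJ_order (μ : ℝ) {x : ℝ} (hx : 0 < x) :
    Tendsto (fun κ => besselJ κ x) (𝓝 μ) (𝓝 (besselJ μ x)) :=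
  ((besselJAsymp μ).differentiableAt x hx).continuousAt

open Topology in
lemma tendsto_besselQ_of_nonInt {μ x : ℝ} (hμ : μ ∈ nonInt) (hx : 0 < x) :
    Tendsto (fun κ => besselQ κ x) (𝓝[nonInt] μ) (𝓝 (besselQ μ x)) := by
  refine Tendsto.mono_left ?_ nhdsWithin_le_nhds
  have h2 := (tendsto_besselJ_order (-μ) hx).comp (tendsto_id (α := ℝ) (x := 𝓝 μ)).neg
  have hc : Tendsto (fun κ => Real.cos (κ * π)) (𝓝 μ) (𝓝 (Real.cos (μ * π))) :=
    Continuous.tendsto (by fun_prop) μ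
  have hs : Tendsto (fun κ => Real.sin (κ * π)) (𝓝 μ) (𝓝 (Real.sin (μ * π))) :=
    Continuous.tendsto (by fun_prop) μ
  exact (((tendsto_besselJ_order μ hx).mul hc).sub h2).div hs (sin_mul_pi_ne_zero hμ)

open Topology in
lemma tendsto_besselQ_int (n : ℤ) {x : ℝ} (hx : 0 < x) :
    Tendsto (fun κ => besselQ κ x) (𝓝[nonInt] (n : ℝ))
      (𝓝 ((deriv (fun μ => besselJ μ x) n
        + Real.cos (n * π) * deriv (fun μ => besselJ μ x) (-n)) / π)) := by
  have h1 := ((besselJAsymp n).differentiableAt x hx).hasDerivAt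
  have h2 := ((besselJAsymp (-n)).differentiableAt x hx).hasDerivAt
  have h2' : HasDerivAt (fun μ => besselJ (-μ) x) (-deriv (fun μ => besselJ μ x) (-n)) n := by
    exact (HasDerivAt.scomp (n : ℝ) h2 (hasDerivAt_neg (n : ℝ))).congr_deriv (by simp)
  have hc : HasDerivAt (fun κ : ℝ => Real.cos (κ * π)) (-Real.sin (n * π) * π) n := by
    simpa using ((hasDerivAt_id (n : ℝ)).mul_const π).cos
  have hs : HasDerivAt (fun κ : ℝ => Real.sin (κ * π)) (Real.cos (n * π) * π) n := by
    simpa using ((hasDerivAt_id (n : ℝ)).mul_const π).sin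
  have hN := (h1.mul hc).sub h2'
  have hle : 𝓝[nonInt] (n : ℝ) ≤ 𝓝[≠] (n : ℝ) := nhdsWithin_mono _ fun κ hκ => hκ n
  have hcn := cos_int_mul_pi_sq n
  have hcn0 : Real.cos (n * π) ≠ 0 := left_ne_zero_of_mul_eq_one hcn
  have h := ((hasDerivAt_iff_tendsto_slope.1 hN).mono_left hle).div
    ((hasDerivAt_iff_tendsto_slope.1 hs).mono_left hle) (mul_ne_zero hcn0 Real.pi_ne_zero)
  have hval : (deriv (fun μ => besselJ μ x) n * Real.cos (n * π)
      + besselJ n x * (-Real.sin (n * π) * π) - -deriv (fun μ => besselJ μ x) (-n))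
      / (Real.cos (n * π) * π) = (deriv (fun μ => besselJ μ x) n
        + Real.cos (n * π) * deriv (fun μ => besselJ μ x) (-n)) / π := by
    rw [Real.sin_int_mul_pi]
    field_simp
    linear_combination (-deriv (fun μ => besselJ μ x) (-n)) * hcn
  rw [hval] at h
  refine h.congr' ?_
  filter_upwards [self_mem_nhdsWithin] with κ hκ
  have hκ0 : κ - n ≠ 0 := sub_ne_zero.2 (hκ n)
  have hsκ := sin_mul_pi_ne_zero hκ
  simp only [slope_def_field, Pi.sub_apply, Pi.mul_apply, Pi.div_apply]
  rw [besselJ_neg_int n hx, Real.sin_int_mul_pi, besselQ]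
  field_simp
  ring

open Topology in
/-- The limit defining `Y_μ(x)` exists. -/
lemma tendsto_besselQ (μ : ℝ) {x : ℝ} (hx : 0 < x) :
    Tendsto (fun κ => besselQ κ x) (𝓝[nonInt] μ) (𝓝 (besselY μ x)) := by
  refine tendsto_nhds_limUnder ?_
  by_cases h : μ ∈ nonInt
  · exact ⟨_, tendsto_besselQ_of_nonInt h hx⟩
  · simp only [nonInt, Set.mem_ofPred_eq, not_forall, not_not] at h
    obtain ⟨n, rfl⟩ := h
    exact ⟨_, tendsto_besselQ_int n hx⟩

lemma besselY_of_nonInt {μ x : ℝ} (hμ : μ ∈ nonInt) (hx : 0 < x) :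
    besselY μ x = besselQ μ x := by
  have := nhdsWithin_nonInt_neBot μ
  exact tendsto_nhds_unique (tendsto_besselQ μ hx) (tendsto_besselQ_of_nonInt hμ hx)

lemma besselY_int (n : ℤ) {x : ℝ} (hx : 0 < x) :
    besselY n x = (deriv (fun μ => besselJ μ x) n
        + Real.cos (n * π) * deriv (fun μ => besselJ μ x) (-n)) / π := by
  have := nhdsWithin_nonInt_neBot (n : ℝ)
  exact tendsto_nhds_unique (tendsto_besselQ n hx) (tendsto_besselQ_int n hx)

lemma besselPhase_neg (ν x : ℝ) : besselPhase (-ν) x = besselPhase ν x + ν * π := by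
  unfold besselPhase; ring

open Topology in
/-- Leading-order asymptotics of `Y_μ`. -/
lemma tendsto_besselY (μ : ℝ) :
    Tendsto (fun x => √x * besselY μ x - √(2 / π) * Real.sin (besselPhase μ x)) atTop (𝓝 0) := by
  by_cases h : μ ∈ nonInt
  · have hs := sin_mul_pi_ne_zero h
    have := (((besselJAsymp μ).tendsto.mul_const (Real.cos (μ * π))).sub
      (besselJAsymp (-μ)).tendsto).div_const (Real.sin (μ * π))
    rw [zero_mul, sub_zero, zero_div] at this
    refine this.congr' ?_
    filter_upwards [eventually_gt_atTop 0] with x hx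
    rw [besselY_of_nonInt h hx, besselQ, besselPhase_neg, Real.cos_add]
    generalize Real.sin (μ * π) = s at *
    field_simp
    ring
  · simp only [nonInt, Set.mem_ofPred_eq, not_forall, not_not] at h
    obtain ⟨n, rfl⟩ := h
    have hcn := cos_int_mul_pi_sq n
    have := ((besselJAsymp n).tendsto_deriv.add
      ((besselJAsymp (-n)).tendsto_deriv.const_mul (Real.cos (n * π)))).div_const π
    rw [mul_zero, add_zero, zero_div] at this
    refine this.congr' ?_
    filter_upwards [eventually_gt_atTop 0] with x hx
    rw [besselY_int n hx, besselPhase_neg, Real.sin_add, Real.sin_int_mul_pi]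
    generalize Real.cos (n * π) = c at *
    field_simp
    linear_combination (-√(2 / π) * π * Real.sin (besselPhase n x)) * hcn

lemma besselJ_mul_besselQ_sub {κ x : ℝ} (hκ : κ ∈ nonInt) (hx : 0 < x) :
    besselJ κ x * besselQ (κ - 1) x - besselJ (κ - 1) x * besselQ κ x = 2 / (π * x) := by
  have h := besselW_neg hκ hx
  have hs := sin_mul_pi_ne_zero hκ
  have e := besselJ_sub_one κ hx
  unfold besselW besselD at h
  unfold besselQ
  rw [sub_one_mul, Real.cos_sub_pi, Real.sin_sub_pi, show -(κ - 1) = -κ + 1 by ring, e]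
  rw [eq_div_iff (by positivity)]
  have e3 : Real.sin (κ * π) = -(besselJ κ x * (-κ * besselJ (-κ) x - x * besselJ (-κ + 1) x) -
    (κ * besselJ κ x - x * besselJ (κ + 1) x) * besselJ (-κ) x) * π / 2 := by
    rw [h]; field_simp
  generalize Real.sin (κ * π) = s at *
  field_simp
  rw [e3]
  ring

open Topology in
lemma besselJ_mul_besselY_sub (μ : ℝ) {x : ℝ} (hx : 0 < x) :
    besselJ μ x * besselY (μ - 1) x - besselJ (μ - 1) x * besselY μ x = 2 / (π * x) := by
  have hne := nhdsWithin_nonInt_neBot μ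
  have hsub : Tendsto (fun κ : ℝ => κ - 1) (𝓝[nonInt] μ) (𝓝[nonInt] (μ - 1)) := by
    refine tendsto_nhdsWithin_iff.2 ⟨?_, ?_⟩
    · exact ((continuous_id.sub continuous_const).tendsto μ).mono_left nhdsWithin_le_nhds
    · filter_upwards [self_mem_nhdsWithin] with κ hκ n hn
      exact hκ (n + 1) (by push_cast; linarith)
  have hJ : ∀ ν : ℝ, Tendsto (fun κ => besselJ κ x) (𝓝[nonInt] ν) (𝓝 (besselJ ν x)) :=
    fun ν => (tendsto_besselJ_order ν hx).mono_left nhdsWithin_le_nhds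
  have h := ((hJ μ).mul ((tendsto_besselQ (μ - 1) hx).comp hsub)).sub
    (((hJ (μ - 1)).comp hsub).mul (tendsto_besselQ μ hx))
  refine tendsto_nhds_unique h (tendsto_const_nhds.congr' ?_)
  filter_upwards [self_mem_nhdsWithin] with κ hκ
  exact (besselJ_mul_besselQ_sub hκ hx).symm

lemma besselJ_ne_zero_of_besselY_eq_zero {μ x : ℝ} (hx : 0 < x) (h : besselY μ x = 0) :
    besselJ μ x ≠ 0 := by
  intro h0
  have := besselJ_mul_besselY_sub μ hx
  rw [h, h0, zero_mul, mul_zero, sub_zero] at this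
  have : 0 < 2 / (π * x) := by positivity
  linarith

lemma hasDerivAt_besselQ_div_besselJ {κ x : ℝ} (hκ : κ ∈ nonInt) (hx : 0 < x)
    (hJ : besselJ κ x ≠ 0) :
    HasDerivAt (fun x => besselQ κ x / besselJ κ x) (2 / (π * x * besselJ κ x ^ 2)) x := by
  have h := besselW_neg hκ hx
  have hs := sin_mul_pi_ne_zero hκ
  have h1 := hasDerivAt_besselJ' κ hx
  have hQ := ((h1.mul_const (Real.cos (κ * π))).sub (hasDerivAt_besselJ' (-κ) hx)).div_const
    (Real.sin (κ * π))
  refine (hQ.div h1 hJ).congr_deriv ?_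
  unfold besselW at h
  have e3 : Real.sin (κ * π) = -(besselJ κ x * besselD (-κ) x - besselD κ x * besselJ (-κ) x)
      * π / 2 := by
    rw [h]; field_simp
  simp only [Pi.sub_apply]
  generalize Real.sin (κ * π) = s at *
  field_simp
  rw [e3]
  ring

lemma continuousAt_besselCoeff {ν : ℝ} (hν : 0 < ν) (k : ℕ) :
    ContinuousAt (fun ν => besselCoeff ν k) ν := by
  have hk : (0 : ℝ) ≤ k := by positivity
  have hg : ContinuousAt Real.Gamma (ν + k + 1) :=
    (Real.differentiableAt_Gamma fun m => by
      have : (0 : ℝ) ≤ m := by positivity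
      linarith).continuousAt
  have hg' : ContinuousAt (fun ν : ℝ => Real.Gamma (ν + k + 1)) ν :=
    ContinuousAt.comp (f := fun ν : ℝ => ν + k + 1) hg (by fun_prop)
  have := Real.Gamma_pos_of_pos (show 0 < ν + k + 1 by linarith)
  exact continuousAt_const.div (continuousAt_const.mul hg') (by positivity)

lemma continuousAt_besselJ_prod {μ x : ℝ} (hμ : 1 < μ) (hx : 0 < x) :
    ContinuousAt (fun p : ℝ × ℝ => besselJ p.1 p.2) (μ, x) := by
  set s : Set (ℝ × ℝ) := {p | 1 < p.1 ∧ |p.2| < x ^ 2 / 4 + 1} with hs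
  have hso : IsOpen s := (isOpen_lt continuous_const continuous_fst).inter
    (isOpen_lt continuous_snd.abs continuous_const)
  have hc : ContinuousOn (fun p : ℝ × ℝ => besselCore p.1 p.2) s := by
    have hsum : Summable fun k : ℕ => (x ^ 2 / 4 + 1) ^ k / (k.factorial : ℝ) :=
      Real.summable_pow_div_factorial _
    refine continuousOn_tsum (fun k p hp => ?_) hsum fun k p hp => ?_
    · have h1 : ContinuousAt (fun p : ℝ × ℝ => besselCoeff p.1 k) p :=
        ContinuousAt.comp (f := Prod.fst)
          (continuousAt_besselCoeff (zero_lt_one.trans hp.1) k) continuousAt_fst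
      exact (h1.mul (continuousAt_snd.pow k)).continuousWithinAt
    · have hk : (0 : ℝ) ≤ k := by positivity
      rw [norm_mul, norm_pow, Real.norm_eq_abs, Real.norm_eq_abs, div_eq_inv_mul]
      have h1 := abs_besselCoeff_le (ν := p.1) (k := k) (by linarith [hp.1])
      rw [one_div] at h1
      have h2 := hp.2.le
      gcongr
  have hmem : (μ, x ^ 2 / 4) ∈ s := by
    refine ⟨hμ, ?_⟩
    rw [abs_of_nonneg (by positivity)]; linarith
  have h1 : ContinuousAt (fun p : ℝ × ℝ => besselCore p.1 (p.2 ^ 2 / 4)) (μ, x) :=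
    ContinuousAt.comp (f := fun p : ℝ × ℝ => (p.1, p.2 ^ 2 / 4)) (x := (μ, x))
      (hc.continuousAt (hso.mem_nhds hmem)) (by fun_prop)
  have h2 : ContinuousAt (fun p : ℝ × ℝ => (p.2 / 2) ^ p.1) (μ, x) :=
    ContinuousAt.rpow (by fun_prop) (by fun_prop) (Or.inl (by simp; positivity))
  refine (h2.mul h1).congr ?_
  filter_upwards [(isOpen_lt continuous_const continuous_snd).mem_nhds
    (show (0 : ℝ) < (μ, x).2 from hx)] with p hp
  exact (besselJ_eq _ hp).symm

open Topology in
lemma exists_besselJ_zero_of_besselY_zeros {μ a b : ℝ} (hμ : 1 < μ) (ha : 0 < a) (hab : a < b)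
    (hYa : besselY μ a = 0) (hYb : besselY μ b = 0) : ∃ c ∈ Set.Ioo a b, besselJ μ c = 0 := by
  by_contra! hcon
  have hb : 0 < b := ha.trans hab
  have hJa := besselJ_ne_zero_of_besselY_eq_zero ha hYa
  have hJb := besselJ_ne_zero_of_besselY_eq_zero hb hYb
  have hne : ∀ x ∈ Set.Icc a b, besselJ μ x ≠ 0 := by
    intro x hx
    rcases hx.1.eq_or_lt with rfl | h1
    · exact hJa
    rcases hx.2.eq_or_lt with rfl | h2
    · exact hJb
    exact hcon x ⟨h1, h2⟩
  have hsub : Set.Icc a b ⊆ Set.Ioi 0 := fun x hx => ha.trans_le hx.1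
  obtain ⟨M, hM⟩ := isCompact_Icc.exists_bound_of_continuousOn ((continuousOn_besselJ μ).mono hsub)
  have hM0 : 0 ≤ M := (norm_nonneg _).trans (hM a ⟨le_rfl, hab.le⟩)
  have hev : ∀ᶠ κ in 𝓝 μ, ∀ x ∈ Set.Icc a b, besselJ κ x ≠ 0 ∧ |besselJ κ x| < M + 1 := by
    refine isCompact_Icc.eventually_forall_of_forall_eventually fun x hx => ?_
    have hc := continuousAt_besselJ_prod hμ (hsub hx)
    refine (hc.eventually_ne (hne x hx)).and ?_
    refine hc.abs.eventually_lt_const ?_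
    have := hM x hx
    rw [Real.norm_eq_abs] at this
    simpa using this.trans_lt (lt_add_one M)
  set c := 2 / (π * b * (M + 1) ^ 2)
  have hc : 0 < c := by positivity
  have hlow : ∀ᶠ κ in 𝓝[nonInt] μ,
      c * (b - a) ≤ besselQ κ b / besselJ κ b - besselQ κ a / besselJ κ a := by
    filter_upwards [self_mem_nhdsWithin, nhdsWithin_le_nhds hev] with κ hκ hx
    have hd : ∀ x ∈ Set.Icc a b, HasDerivAt (fun x => besselQ κ x / besselJ κ x)
        (2 / (π * x * besselJ κ x ^ 2)) x :=
      fun x h => hasDerivAt_besselQ_div_besselJ hκ (hsub h) (hx x h).1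
    obtain ⟨y, hy, he⟩ := exists_hasDerivAt_eq_slope _ _ hab
      (fun x h => (hd x h).continuousAt.continuousWithinAt)
      (fun x h => hd x (Set.Ioo_subset_Icc_self h))
    have hy' := Set.Ioo_subset_Icc_self hy
    have hy0 : 0 < y := hsub hy'
    rw [eq_div_iff (by linarith)] at he
    rw [← he]
    have hJ0 := (hx y hy').1
    have hJ2 : 0 < besselJ κ y ^ 2 := by positivity
    have hJ3 : besselJ κ y ^ 2 ≤ (M + 1) ^ 2 := by
      rw [← sq_abs]
      exact pow_le_pow_left₀ (abs_nonneg _) (hx y hy').2.le 2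
    have hba : 0 ≤ b - a := by linarith
    have hyb := hy.2.le
    refine mul_le_mul_of_nonneg_right ?_ hba
    simp only [c]
    gcongr
  have hlim : Tendsto (fun κ => besselQ κ b / besselJ κ b - besselQ κ a / besselJ κ a)
      (𝓝[nonInt] μ) (𝓝 (besselY μ b / besselJ μ b - besselY μ a / besselJ μ a)) :=
    ((tendsto_besselQ μ hb).div ((tendsto_besselJ_order μ hb).mono_left nhdsWithin_le_nhds)
      hJb).sub ((tendsto_besselQ μ ha).div
        ((tendsto_besselJ_order μ ha).mono_left nhdsWithin_le_nhds) hJa)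
  have hne' := nhdsWithin_nonInt_neBot μ
  have h0 := ge_of_tendsto hlim hlow
  rw [hYa, hYb, zero_div, zero_div, sub_zero] at h0
  have : 0 < c * (b - a) := mul_pos hc (by linarith)
  linarith

/-- The point at which `besselPhase κ` equals `m * π + t`. -/
noncomputable def phasePoint (κ : ℝ) (m : ℕ) (t : ℝ) : ℝ := (m + κ / 2 + 1 / 4) * π + t

lemma besselPhase_phasePoint (κ : ℝ) (m : ℕ) (t : ℝ) :
    besselPhase κ (phasePoint κ m t) = t + m * π := by
  unfold besselPhase phasePoint; ring

lemma tendsto_phasePoint (κ t : ℝ) : Tendsto (fun m => phasePoint κ m t) atTop atTop := by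
  unfold phasePoint
  refine tendsto_atTop_add_const_right _ _ (Tendsto.atTop_mul_const Real.pi_pos ?_)
  simp only [add_assoc]
  exact tendsto_atTop_add_const_right _ _ tendsto_natCast_atTop_atTop

lemma phasePoint_pos {κ t : ℝ} {m : ℕ} (hκ : 0 ≤ κ) (ht : 0 ≤ t) : 0 < phasePoint κ m t := by
  unfold phasePoint; positivity

open Topology in
lemma eventually_sign_of_asymp {f g : ℝ → ℝ} {κ δ : ℝ} (T : ℝ) (hδ : 0 < δ)
    (hg : ∀ t : ℝ, ∀ m : ℕ, g (t + m * π) = (-1) ^ m * g t)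
    (h : Tendsto (fun x => √x * f x - √(2 / π) * g (besselPhase κ x)) atTop (𝓝 0)) :
    ∀ᶠ m : ℕ in atTop, ∀ t, T ≤ t →
      (δ ≤ g t → 0 < (-1) ^ m * f (phasePoint κ m t)) ∧
      (g t ≤ -δ → (-1) ^ m * f (phasePoint κ m t) < 0) := by
  have hC : 0 < √(2 / π) := by positivity
  have hb : |(0 : ℝ)| < √(2 / π) * δ := by
    rw [abs_zero]
    exact mul_pos hC hδ
  obtain ⟨X, hX⟩ := eventually_atTop.1
    ((h.abs.eventually_lt_const hb).and (eventually_gt_atTop 0))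
  filter_upwards [(tendsto_phasePoint κ T).eventually_ge_atTop X] with m hm t ht
  obtain ⟨h1, h2⟩ := hX (phasePoint κ m t) (hm.trans (by unfold phasePoint; linarith))
  rw [besselPhase_phasePoint, hg] at h1
  have hs : 0 < √(phasePoint κ m t) := Real.sqrt_pos.2 h2
  generalize √(phasePoint κ m t) = s at *
  generalize f (phasePoint κ m t) = F at *
  have h3 : |s * ((-1) ^ m * F) - √(2 / π) * g t| < √(2 / π) * δ := by
    refine lt_of_eq_of_lt ?_ h1
    rcases neg_one_pow_eq_or ℝ m with e | e <;> rw [e]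
    · ring_nf
    · rw [← abs_neg]; ring_nf
  rw [abs_lt] at h3
  constructor
  · intro hc
    have := mul_le_mul_of_nonneg_left hc hC.le
    exact pos_of_mul_pos_right (b := (-1) ^ m * F) (a := s) (by linarith) hs.le
  · intro hc
    have := mul_le_mul_of_nonneg_left hc hC.le
    by_contra! hcon
    have := mul_nonneg hs.le hcon
    linarith

lemma eventually_sign_besselJ (κ T : ℝ) {δ : ℝ} (hδ : 0 < δ) :
    ∀ᶠ m : ℕ in atTop, ∀ t, T ≤ t →
      (δ ≤ Real.cos t → 0 < (-1) ^ m * besselJ κ (phasePoint κ m t)) ∧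
      (Real.cos t ≤ -δ → (-1) ^ m * besselJ κ (phasePoint κ m t) < 0) :=
  eventually_sign_of_asymp T hδ (fun t m => Real.cos_add_nat_mul_pi t m) (besselJAsymp κ).tendsto

lemma eventually_sign_besselY (κ T : ℝ) {δ : ℝ} (hδ : 0 < δ) :
    ∀ᶠ m : ℕ in atTop, ∀ t, T ≤ t →
      (δ ≤ Real.sin t → 0 < (-1) ^ m * besselY κ (phasePoint κ m t)) ∧
      (Real.sin t ≤ -δ → (-1) ^ m * besselY κ (phasePoint κ m t) < 0) :=
  eventually_sign_of_asymp T hδ (fun t m => Real.sin_add_nat_mul_pi t m) (tendsto_besselY κ)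

lemma exists_besselJ_zero_of_sign {κ a b c : ℝ} (ha : 0 < a) (hab : a ≤ b)
    (h : 0 < c * besselJ κ a * (-(c * besselJ κ b))) : ∃ x ∈ Set.Ioc a b, besselJ κ x = 0 := by
  have hc : c ≠ 0 := by rintro rfl; simp at h
  have hJa : besselJ κ a ≠ 0 := by intro h0; simp [h0] at h
  have hcont : ContinuousOn (besselJ κ) (Set.uIcc a b) := by
    rw [Set.uIcc_of_le hab]
    exact (continuousOn_besselJ κ).mono fun x hx => ha.trans_le hx.1
  have hlt : besselJ κ a * besselJ κ b < 0 := by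
    have : 0 < c ^ 2 := by positivity
    nlinarith
  have h0 : (0 : ℝ) ∈ Set.uIcc (besselJ κ a) (besselJ κ b) := by
    rw [Set.mem_uIcc]
    rcases mul_neg_iff.1 hlt with h | h
    · exact Or.inr ⟨h.2.le, h.1.le⟩
    · exact Or.inl ⟨h.1.le, h.2.le⟩
  obtain ⟨x, hx, hx0⟩ := intermediate_value_uIcc hcont h0
  rw [Set.uIcc_of_le hab] at hx
  exact ⟨x, ⟨lt_of_le_of_ne hx.1 fun h => hJa (h ▸ hx0), hx.2⟩, hx0⟩

lemma eventually_encard_besselJZeros_le_of_lt_add_one {ν κ : ℝ} (hν : 0 ≤ ν) (h1 : ν < κ)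
    (h2 : κ < ν + 1) : ∀ᶠ m : ℕ in atTop,
      (besselJZeros κ (phasePoint κ m 0)).encard ≤ (besselJZeros ν (phasePoint ν m 0)).encard := by
  have hπ := Real.pi_pos
  have hδ : 0 < Real.cos ((κ - ν) * π / 2) :=
    Real.cos_pos_of_mem_Ioo ⟨by nlinarith, by nlinarith⟩
  filter_upwards [eventually_sign_besselJ ν 0 hδ] with m hm
  refine (encard_besselJZeros_le hν h1 _).trans (Set.encard_le_encard ?_)
  rintro x ⟨hx0, hxX, hJ⟩
  refine ⟨hx0, ?_, hJ⟩
  by_contra! hcon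
  obtain ⟨t, rfl⟩ : ∃ t, x = phasePoint ν m t :=
    ⟨x - phasePoint ν m 0, by unfold phasePoint; ring⟩
  unfold phasePoint at hxX hcon
  have ht0 : 0 < t := by linarith
  have ht1 : t ≤ (κ - ν) * π / 2 := by linarith
  have := (hm t ht0.le).1 (Real.cos_le_cos_of_nonneg_of_le_pi ht0.le (by nlinarith) ht1)
  simp [hJ] at this

lemma eventually_encard_besselJZeros_le {ν κ : ℝ} (hν : 0 ≤ ν) (h : ν < κ) :
    ∀ᶠ m : ℕ in atTop,
      (besselJZeros κ (phasePoint κ m 0)).encard ≤ (besselJZeros ν (phasePoint ν m 0)).encard := by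
  obtain ⟨k, hk⟩ := exists_nat_gt (κ - ν)
  have hk0 : (0 : ℝ) < k := by linarith
  set d := (κ - ν) / k with hd
  have hd0 : 0 < d := div_pos (by linarith) hk0
  have hd1 : d < 1 := (div_lt_one hk0).2 hk
  have key : ∀ i : ℕ, ∀ᶠ m : ℕ in atTop,
      (besselJZeros (ν + i * d) (phasePoint (ν + i * d) m 0)).encard ≤
        (besselJZeros ν (phasePoint ν m 0)).encard := by
    intro i
    induction i with
    | zero => simp
    | succ i ih =>
      have := eventually_encard_besselJZeros_le_of_lt_add_one (ν := ν + i * d)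
        (κ := ν + (i + 1 : ℕ) * d) (by positivity) (by push_cast; linarith)
        (by push_cast; linarith)
      filter_upwards [ih, this] with m h1 h2
      exact h2.trans h1
  have e : ν + k * d = κ := by rw [hd]; field_simp; ring
  simpa only [e] using key k

lemma IsPosZeroSeq.le_of_le_encard {f : ℝ → ℝ} {z : ℕ → ℝ} (hz : IsPosZeroSeq f z) {n : ℕ} {X : ℝ}
    (h : ((n + 1 : ℕ) : ℕ∞) ≤ {x | 0 < x ∧ x ≤ X ∧ f x = 0}.encard) : z (n + 1) ≤ X := by
  by_contra! hcon
  have hsub : {x | 0 < x ∧ x ≤ X ∧ f x = 0} ⊆ z '' (Finset.Icc 1 n : Finset ℕ) := by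
    rintro x ⟨h0, hX, hf⟩
    obtain ⟨s, hs, rfl⟩ := hz.complete x h0 hf
    refine ⟨s, ?_, rfl⟩
    simp only [Finset.coe_Icc, Set.mem_Icc]
    refine ⟨hs, ?_⟩
    by_contra! hns
    rcases (Nat.succ_le_of_lt hns).eq_or_lt with e | hlt
    · rw [← e] at hX; exact absurd hX hcon.not_ge
    · exact absurd (hz.mono (n + 1) s (by omega) hlt) (by linarith)
  have := h.trans ((Set.encard_le_encard hsub).trans (Set.encard_image_le _ _))
  rw [Set.encard_coe_eq_coe_finsetCard, Nat.card_Icc] at this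
  have := Nat.cast_le.1 this
  omega

lemma exists_besselJ_zeros_of_besselY_zeroSeq {μ : ℝ} (hμ : 1 < μ) {z : ℕ → ℝ}
    (hz : IsPosZeroSeq (besselY μ) z) (n : ℕ) :
    (n : ℕ∞) ≤ (besselJZeros μ (z (n + 1))).encard := by
  have hex : ∀ i : ℕ, ∃ c ∈ Set.Ioo (z (i + 1)) (z (i + 2)), besselJ μ c = 0 := fun i =>
    exists_besselJ_zero_of_besselY_zeros hμ (hz.pos _ (by omega))
      (hz.mono _ _ (by omega) (by omega)) (hz.isZero _ (by omega)) (hz.isZero _ (by omega))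
  choose c hc hJ using hex
  have hmono : StrictMono c := strictMono_nat_of_lt_succ fun i => (hc i).2.trans (hc (i + 1)).1
  have hsub : c '' (Finset.range n : Finset ℕ) ⊆ besselJZeros μ (z (n + 1)) := by
    rintro _ ⟨i, hi, rfl⟩
    have hi : i < n := by simpa using hi
    refine ⟨(hz.pos _ (by omega)).trans (hc i).1, (hc i).2.le.trans ?_, hJ i⟩
    rcases (show i + 2 ≤ n + 1 by omega).eq_or_lt with e | hlt
    · rw [e]
    · exact (hz.mono _ _ (by omega) hlt).le
  refine le_trans ?_ (Set.encard_le_encard hsub)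
  rw [hmono.injective.encard_image, Set.encard_coe_eq_coe_finsetCard, Finset.card_range]

lemma encard_besselJZeros_add_one_le {κ X Y c : ℝ} (hX : 0 < X) (hc : c ∈ Set.Ioc X Y)
    (hJ : besselJ κ c = 0) : (besselJZeros κ X).encard + 1 ≤ (besselJZeros κ Y).encard := by
  rw [← Set.encard_insert_of_notMem (a := c) fun h => absurd h.2.1 hc.1.not_ge]
  refine Set.encard_le_encard (Set.insert_subset ⟨hX.trans hc.1, hc.2, hJ⟩ ?_)
  exact besselJZeros_mono κ (hc.1.le.trans hc.2)

lemma exists_besselJ_zero_lt_besselY_zero {ν ε : ℝ} (hν : 0 ≤ ν) (hε : 1 < ε) {j yε : ℕ → ℝ}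
    (hj : IsPosZeroSeq (besselJ ν) j) (hyε : IsPosZeroSeq (besselY (ν + ε)) yε) :
    ∃ s : ℕ, 1 ≤ s ∧ j s < yε s := by
  have hπ := Real.pi_pos
  obtain ⟨η, hη0, hη1, hη2⟩ : ∃ η : ℝ, 0 < η ∧ η ≤ π / 8 ∧ η ≤ (ε - 1) * π / 4 :=
    ⟨min (π / 8) ((ε - 1) * π / 4), lt_min (by positivity)
      (div_pos (mul_pos (by linarith) hπ) (by norm_num)), min_le_left _ _, min_le_right _ _⟩
  have hsin : 0 < Real.sin η := Real.sin_pos_of_pos_of_lt_pi hη0 (by linarith)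
  have hcos : 0 < Real.cos η := Real.cos_pos_of_mem_Ioo ⟨by linarith, by linarith⟩
  obtain ⟨m, hcard, hJμ, hYμ, hJν, hm0⟩ :=
    ((eventually_encard_besselJZeros_le hν (show ν < ν + ε by linarith)).and
      ((eventually_sign_besselJ (ν + ε) (-π) hcos).and
        ((eventually_sign_besselY (ν + ε) (-π) hsin).and
          ((eventually_sign_besselJ ν 0 hsin).and
            ((tendsto_phasePoint (ν + ε) (-π)).eventually_gt_atTop 0))))).exists
  have hlow : 0 < phasePoint (ν + ε) m (-π + η) := by
    unfold phasePoint at hm0 ⊢; linarith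
  have hle : phasePoint (ν + ε) m (-π + η) ≤ phasePoint (ν + ε) m (-η) := by
    unfold phasePoint; linarith
  obtain ⟨c, hc, hcJ⟩ : ∃ x ∈ Set.Ioc (phasePoint (ν + ε) m (-π + η)) (phasePoint (ν + ε) m (-η)),
      besselJ (ν + ε) x = 0 := by
    refine exists_besselJ_zero_of_sign (c := (-1) ^ m) hlow hle ?_
    have h1 := (hJμ (-π + η) (by linarith)).2
      (by rw [neg_add_eq_sub, Real.cos_sub_pi])
    have h2 := (hJμ (-η) (by linarith)).1 (by rw [Real.cos_neg])
    exact mul_pos_of_neg_of_neg h1 (by linarith)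
  have hν0 : 0 < phasePoint ν m 0 := phasePoint_pos hν le_rfl
  obtain ⟨d, hd, hdJ⟩ : ∃ x ∈ Set.Ioc (phasePoint ν m 0) (phasePoint ν m (π / 2 + η)),
      besselJ ν x = 0 := by
    refine exists_besselJ_zero_of_sign (c := (-1) ^ m) hν0
      (by unfold phasePoint; linarith) ?_
    have h1 := (hJν 0 le_rfl).1 (by rw [Real.cos_zero]; exact Real.sin_le_one _)
    have h2 := (hJν (π / 2 + η) (by linarith)).2
      (by rw [add_comm, Real.cos_add_pi_div_two])
    exact mul_pos h1 (by linarith)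
  set X := phasePoint (ν + ε) m (-η) with hX
  have hdX : phasePoint ν m (π / 2 + η) ≤ X := by
    rw [hX]; unfold phasePoint; nlinarith
  have hfin : (besselJZeros (ν + ε) X).Finite := finite_zeros_besselJ (by linarith) X
  obtain ⟨n, hn⟩ : ∃ n : ℕ, (besselJZeros (ν + ε) X).encard = n :=
    ⟨_, hfin.cast_ncard_eq.symm⟩
  refine ⟨n + 1, by omega, lt_of_le_of_lt (b := X) ?_ ?_⟩
  · refine hj.le_of_le_encard ?_
    have h1 := encard_besselJZeros_add_one_le hν0 ⟨hd.1, hd.2.trans hdX⟩ hdJ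
    have h2 : (n : ℕ∞) ≤ (besselJZeros ν (phasePoint ν m 0)).encard := by
      rw [← hn]
      refine (Set.encard_le_encard (besselJZeros_mono _ ?_)).trans hcard
      rw [hX]; unfold phasePoint; linarith
    push_cast
    exact (add_le_add_left h2 1).trans h1
  · by_contra! hcon
    have hY0 := hyε.isZero (n + 1) (by omega)
    have hle' : yε (n + 1) ≤ phasePoint (ν + ε) m (-π + η) := by
      by_contra! hlt
      obtain ⟨t, ht⟩ : ∃ t, yε (n + 1) = phasePoint (ν + ε) m t :=
        ⟨yε (n + 1) - phasePoint (ν + ε) m 0, by unfold phasePoint; ring⟩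
      rw [ht] at hlt hcon hY0
      rw [hX] at hcon
      unfold phasePoint at hlt hcon
      have h1 : -π + η < t := by linarith
      have h2 : t ≤ -η := by linarith
      have hs : Real.sin t ≤ -Real.sin η := by
        have : Real.sin η ≤ Real.sin (t + π) := by
          rcases le_total (t + π) (π / 2) with h | h
          · exact Real.sin_le_sin_of_le_of_le_pi_div_two (by linarith) h (by linarith)
          · rw [← Real.sin_pi_sub (t + π)]
            exact Real.sin_le_sin_of_le_of_le_pi_div_two (by linarith) (by linarith) (by linarith)
        rw [Real.sin_add_pi] at this
        linarith
      have := (hYμ t (by linarith)).2 hs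
      simp [hY0] at this
    have h1 := exists_besselJ_zeros_of_besselY_zeroSeq (show 1 < ν + ε by linarith) hyε n
    have h2 := encard_besselJZeros_add_one_le hlow hc hcJ
    have h3 := (Set.encard_le_encard (besselJZeros_mono (ν + ε) hle'))
    rw [hn] at h2
    have h4 := (add_le_add_left (h1.trans h3) 1).trans h2
    have h5 : n + 1 ≤ n := by exact_mod_cast h4
    omega

/-- Breaking of the unified interlacing for `ε > 1`: there is some `s ≥ 1` with
`y_{ν+ε,s} > j_{ν,s}`; in particular the chain
`j'_{ν,s} < y_{ν,s} < y_{ν+ε,s} < y'_{ν,s} < j_{ν,s} < j_{ν+ε,s} < j'_{ν,s+1}`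
fails for some `s`. -/
theorem bessel_zeros_unified_interlace_breaks (ν ε : ℝ) (hν : 0 ≤ ν)
    (hε : 1 < ε)
    (j jε y yε j' y' : ℕ → ℝ)
    (hj : IsPosZeroSeq (besselJ ν) j)
    (hjε : IsPosZeroSeq (besselJ (ν + ε)) jε)
    (hy : IsPosZeroSeq (besselY ν) y)
    (hyε : IsPosZeroSeq (besselY (ν + ε)) yε)
    (hj' : IsBesselJDerivZeroSeq ν j')
    (hy' : IsPosZeroSeq (deriv (besselY ν)) y') :
    (∃ s : ℕ, 1 ≤ s ∧ j s < yε s) ∧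
      ¬ ∀ s : ℕ, 1 ≤ s →
        j' s < y s ∧ y s < yε s ∧ yε s < y' s ∧ y' s < j s ∧
          j s < jε s ∧ jε s < j' (s + 1) := by
  have h := exists_besselJ_zero_lt_besselY_zero hν hε hj hyε
  refine ⟨h, fun hall => ?_⟩
  obtain ⟨s, hs, hlt⟩ := h
  obtain ⟨-, -, h1, h2, -⟩ := hall s hs
  exact lt_asymm hlt (h1.trans h2)
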